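/- arXiv:0801.0857 — 11 statements merged into one kernel-verified Lean document; each statement's English description precedes it below -/
import Mathlib

section
/- Let u and v be positive integers and let w = gcd(u, v). Then gcd(2^u − 1, 2^v + 1) = 1 if u/w is odd, and gcd(2^u − 1, 2^v + 1) = 2^w + 1 if u/w is even. -/
section Ring

variable {R : Type*} [Ring R] {x : R} {a b : ℕ}

lemma eq_one_of_pow_eq_one_of_pow_eq_neg_one (hab : Nat.Coprime a b) (ha : Odd a)
    (hxa : x ^ a = 1) (hxb : x ^ b = -1) : x = 1 := by
  have hxb' : x ^ (2 * b) = 1 := by rw [mul_comm, pow_mul, hxb, neg_one_sq]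
  have hcop : Nat.gcd a (2 * b) = 1 := ha.coprime_two_right.mul_right hab
  simpa [hcop] using pow_gcd_eq_one.mpr ⟨hxa, hxb'⟩

lemma eq_neg_one_of_pow_eq_one_of_pow_eq_neg_one (hab : Nat.Coprime a b) (ha : Even a)
    (hxa : x ^ a = 1) (hxb : x ^ b = -1) : x = -1 := by
  have hxb' : x ^ (2 * b) = 1 := by rw [mul_comm, pow_mul, hxb, neg_one_sq]
  have hb : Odd b := Nat.coprime_two_left.mp (hab.coprime_dvd_left ha.two_dvd)
  have hgcd : Nat.gcd a (2 * b) = 2 := by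
    rw [hab.symm.gcd_mul_right_cancel_right 2, Nat.gcd_eq_right ha.two_dvd]
  have hx : x ^ 2 = 1 := hgcd ▸ pow_gcd_eq_one.mpr ⟨hxa, hxb'⟩
  obtain ⟨k, rfl⟩ := hb
  rwa [pow_succ, pow_mul, hx, one_pow, one_mul] at hxb

end Ring

lemma dvd_pow_sub_one_iff_zmod {d x n : ℕ} (hx : 0 < x) :
    d ∣ x ^ n - 1 ↔ (x : ZMod d) ^ n = 1 := by
  rw [← ZMod.natCast_eq_zero_iff, Nat.cast_sub (Nat.one_le_pow _ _ hx), sub_eq_zero]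
  push_cast
  rfl

lemma dvd_pow_add_one_iff_zmod {d x n : ℕ} :
    d ∣ x ^ n + 1 ↔ (x : ZMod d) ^ n = -1 := by
  rw [← ZMod.natCast_eq_zero_iff, ← add_eq_zero_iff_eq_neg]
  push_cast
  rfl

/-- Let `u` and `v` be positive integers and `w = gcd(u, v)`.
Then `gcd(2^u − 1, 2^v + 1) = 1` if `u/w` is odd, and `gcd(2^u − 1, 2^v + 1) = 2^w + 1`
if `u/w` is even. -/
theorem gcd_two_pow_sub_one_two_pow_add_one (u v : ℕ) (hu : 0 < u) (hv : 0 < v) :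
    (Odd (u / Nat.gcd u v) → Nat.gcd (2 ^ u - 1) (2 ^ v + 1) = 1) ∧
    (Even (u / Nat.gcd u v) → Nat.gcd (2 ^ u - 1) (2 ^ v + 1) = 2 ^ Nat.gcd u v + 1) := by
  have hw : 0 < Nat.gcd u v := Nat.gcd_pos_of_pos_left v hu
  have hab := Nat.coprime_div_gcd_div_gcd hw
  have hua := Nat.mul_div_cancel' (Nat.gcd_dvd_left u v)
  have hvb := Nat.mul_div_cancel' (Nat.gcd_dvd_right u v)
  generalize Nat.gcd u v = w at *
  generalize u / w = a at *
  generalize v / w = b at *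
  subst hua hvb
  rw [pow_mul, pow_mul]
  have hx : 0 < 2 ^ w := by positivity
  have hd₁ := (dvd_pow_sub_one_iff_zmod hx).mp (Nat.gcd_dvd_left ((2 ^ w) ^ a - 1) ((2 ^ w) ^ b + 1))
  have hd₂ := dvd_pow_add_one_iff_zmod.mp (Nat.gcd_dvd_right ((2 ^ w) ^ a - 1) ((2 ^ w) ^ b + 1))
  refine ⟨fun ha => ?_, fun ha => Nat.dvd_antisymm ?_ (Nat.dvd_gcd ?_ ?_)⟩
  · have h_one := eq_one_of_pow_eq_one_of_pow_eq_neg_one hab ha hd₁ hd₂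
    have h_two : Nat.gcd ((2 ^ w) ^ a - 1) ((2 ^ w) ^ b + 1) ∣ 2 := by
      have := dvd_pow_add_one_iff_zmod (x := 1) (n := 1).mpr
        (by rw [h_one, one_pow] at hd₂; simpa using hd₂)
      simpa using this
    have hodd : Odd ((2 ^ w) ^ b + 1) := by
      rw [← pow_mul]
      exact (even_two.pow_of_ne_zero hv.ne').add_one
    exact Nat.eq_one_of_dvd_coprimes (Nat.coprime_two_right.mpr hodd)
      (Nat.gcd_dvd_right _ _) h_two
  · have h := eq_neg_one_of_pow_eq_one_of_pow_eq_neg_one hab ha hd₁ hd₂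
    simpa using dvd_pow_add_one_iff_zmod (n := 1).mpr ((pow_one _).trans h)
  all_goals
    have hx_neg : ((2 ^ w : ℕ) : ZMod (2 ^ w + 1)) = -1 := by
      simpa using dvd_pow_add_one_iff_zmod (x := 2 ^ w) (n := 1).mp (by simp)
  · rw [dvd_pow_sub_one_iff_zmod hx, hx_neg, ha.neg_one_pow]
  · have hb : Odd b := Nat.coprime_two_left.mp (hab.coprime_dvd_left ha.two_dvd)
    rw [dvd_pow_add_one_iff_zmod, hx_neg, hb.neg_one_pow]
end

section
/- Let n ≥ 2 and m = 2n, and let d, i be nonnegative integers and l an integer with 0 < l < n such that d·(2^l + 1) ≡ 2^i (mod 2^n − 1). Then there exist an integer l' with 0 < l' < n and a nonnegative integer i' such that d·(2^{l'} + 1) ≡ 2^{i'} (mod 2^n − 1) and gcd(2^{l'} + 1, 2^m − 1) = 1. -/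
/-- If the dyadic valuation of `l` is smaller than that of `n`, then `2 ^ l + 1` and `2 ^ n - 1`
are not coprime. -/
theorem not_coprime_two_pow_add_one_two_pow_sub_one {a b c e : ℕ} (he : Odd e) (hca : c < a) :
    ¬ Nat.Coprime (2 ^ (2 ^ c * e) + 1) (2 ^ (2 ^ a * b) - 1) := by
  intro h
  have h₁ : 2 ^ 2 ^ c + 1 ∣ 2 ^ (2 ^ c * e) + 1 := by
    simpa [pow_mul] using he.nat_add_dvd_pow_add_pow (2 ^ 2 ^ c) 1
  have h₂ : 2 ^ 2 ^ c + 1 ∣ 2 ^ (2 ^ a * b) - 1 := by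
    have hsq : 2 ^ 2 ^ c + 1 ∣ 2 ^ 2 ^ (c + 1) - 1 := by
      rw [pow_succ, pow_mul]
      simpa using Dvd.intro _ (Nat.sq_sub_sq (2 ^ 2 ^ c) 1).symm
    exact hsq.trans (Nat.pow_sub_one_dvd_pow_sub_one 2
      ((pow_dvd_pow 2 hca).trans (dvd_mul_right _ _)))
  have h₃ := Nat.eq_one_of_dvd_coprimes h h₁ h₂
  have h₄ : 0 < 2 ^ 2 ^ c := by positivity
  omega

/-- If the dyadic valuation of `l` is at least that of `m`, then `2 ^ l + 1` and `2 ^ m - 1`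
are coprime. -/
theorem coprime_two_pow_add_one_two_pow_sub_one {a b k : ℕ} (hb : Odd b) (hk : 2 ^ a * k ≠ 0) :
    Nat.Coprime (2 ^ (2 ^ a * k) + 1) (2 ^ (2 ^ a * b) - 1) := by
  set g := Nat.gcd (2 ^ (2 ^ a * k) + 1) (2 ^ (2 ^ a * b) - 1)
  have h₁ : (2 : ZMod g) ^ (2 ^ a * k) = -1 := by
    have := (ZMod.natCast_eq_zero_iff _ g).2
      (Nat.gcd_dvd_left (2 ^ (2 ^ a * k) + 1) (2 ^ (2 ^ a * b) - 1))
    push_cast at this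
    exact eq_neg_of_add_eq_zero_left this
  have h₂ : (2 : ZMod g) ^ (2 ^ a * b) = 1 := by
    have := (ZMod.natCast_eq_zero_iff _ g).2
      (Nat.gcd_dvd_right (2 ^ (2 ^ a * k) + 1) (2 ^ (2 ^ a * b) - 1))
    rw [Nat.cast_sub Nat.one_le_two_pow] at this
    push_cast at this
    exact sub_eq_zero.1 this
  have h₃ : (1 : ZMod g) = -1 := by
    calc (1 : ZMod g) = (2 ^ (2 ^ a * b)) ^ k := by rw [h₂, one_pow]
      _ = (2 ^ (2 ^ a * k)) ^ b := by ring
      _ = -1 := by rw [h₁, hb.neg_one_pow]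
  have h₄ : g ∣ 2 := by
    rw [← ZMod.natCast_eq_zero_iff]
    push_cast
    linear_combination h₃
  refine ((Nat.dvd_prime Nat.prime_two).1 h₄).resolve_right fun h => ?_
  have h₅ : 2 ∣ 2 ^ (2 ^ a * k) + 1 := h.symm.dvd.trans (Nat.gcd_dvd_left _ _)
  have h₆ : 2 ∣ 2 ^ (2 ^ a * k) := dvd_pow_self 2 hk
  omega

/-- Replacing `l` by `n - l` changes `2 ^ l + 1` by a power of two modulo `2 ^ n - 1`. -/
theorem mul_two_pow_sub_add_one_modEq {n d i l : ℕ} (hln : l ≤ n)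
    (hd : d * (2 ^ l + 1) ≡ 2 ^ i [MOD 2 ^ n - 1]) :
    d * (2 ^ (n - l) + 1) ≡ 2 ^ (n - l + i) [MOD 2 ^ n - 1] := by
  have h : 2 ^ n ≡ 1 [MOD 2 ^ n - 1] :=
    ((Nat.modEq_iff_dvd' Nat.one_le_two_pow).2 dvd_rfl).symm
  calc d * (2 ^ (n - l) + 1) ≡ d * (2 ^ (n - l) + 2 ^ n) [MOD 2 ^ n - 1] :=
        ((h.symm.add_left _).mul_left _)
    _ = 2 ^ (n - l) * (d * (2 ^ l + 1)) := by
        nth_rewrite 2 [← Nat.sub_add_cancel hln]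
        ring
    _ ≡ 2 ^ (n - l) * 2 ^ i [MOD 2 ^ n - 1] := hd.mul_left _
    _ = 2 ^ (n - l + i) := (pow_add _ _ _).symm

/-- Let `n ≥ 2`, `m = 2n`, and let `d, i` be nonnegative integers and
`l` an integer with `0 < l < n` such that `d·(2^l + 1) ≡ 2^i (mod 2^n − 1)`. Then there
exist `l'` with `0 < l' < n` and `i' ≥ 0` with `d·(2^{l'} + 1) ≡ 2^{i'} (mod 2^n − 1)`
and `gcd(2^{l'} + 1, 2^m − 1) = 1`. -/
theorem exists_good_l (n m d i l : ℕ) (hn : 2 ≤ n) (hm : m = 2 * n)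
    (hl0 : 0 < l) (hln : l < n)
    (hd : d * (2 ^ l + 1) ≡ 2 ^ i [MOD 2 ^ n - 1]) :
    ∃ l' i' : ℕ, 0 < l' ∧ l' < n ∧ d * (2 ^ l' + 1) ≡ 2 ^ i' [MOD 2 ^ n - 1] ∧
      Nat.gcd (2 ^ l' + 1) (2 ^ m - 1) = 1 := by
  have hcop : Nat.Coprime (2 ^ l + 1) (2 ^ n - 1) := by
    have hpow : Nat.Coprime (2 ^ i) (2 ^ n - 1) :=
      Nat.Coprime.pow_left i ((Nat.coprime_two_left).2
        (Nat.Even.sub_odd Nat.one_le_two_pow (even_two.pow_of_ne_zero (by omega)) odd_one))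
    exact Nat.Coprime.coprime_mul_left (hd.gcd_eq.trans hpow)
  obtain ⟨a, b, hb, hab⟩ := Nat.exists_eq_two_pow_mul_odd (n := n) (by omega)
  obtain ⟨c, e, he, hce⟩ := Nat.exists_eq_two_pow_mul_odd (n := l) (by omega)
  have hm' : m = 2 ^ (a + 1) * b := by rw [hm, hab]; ring
  have good : ∀ l', 0 < l' → 2 ^ (a + 1) ∣ l' → Nat.gcd (2 ^ l' + 1) (2 ^ m - 1) = 1 := by
    rintro l' hl' ⟨k, rfl⟩
    rw [hm']
    exact coprime_two_pow_add_one_two_pow_sub_one hb hl'.ne'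
  rcases lt_trichotomy c a with hca | rfl | hac
  · rw [hce, hab] at hcop
    exact absurd hcop (not_coprime_two_pow_add_one_two_pow_sub_one he hca)
  · refine ⟨n - l, n - l + i, by omega, by omega, mul_two_pow_sub_add_one_modEq hln.le hd,
      good _ (by omega) ?_⟩
    rw [hab, hce, ← Nat.mul_sub, pow_succ]
    exact mul_dvd_mul_left _ (Nat.Odd.sub_odd hb he).two_dvd
  · exact ⟨l, i, hl0, hln, hd, good l hl0 (hce ▸ (pow_dvd_pow 2 hac).trans (dvd_mul_right _ _))⟩
end

section
/- Let d be a positive integer and i a nonnegative integer with d·(2^l + 1) ≡ 2^i (mod 2^n − 1). For b ∈ F_{2^n}^*, define ρ_b(y) = tr_m(y^{2^l + 1}) + tr_n(b·y^{2^n + 1}) ∈ {0,1}. Then for every shift τ with 0 ≤ τ ≤ 2^n − 2, writing a = ((β^{dτ}))^(2^{(n − i mod n) mod n}) ∈ F_{2^n}^*, one has C_d(τ) = −1 + Σ_{y ∈ F} (−1)^{ρ_a(y)}; moreover the map τ ↦ a is a bijection from {0, 1, …, 2^n − 2} onto F_{2^n}^*. -/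
open Finset

-- For `v` in the prime subfield `{0,1}` of `F`, `sgnF v` is the integer `(−1)^v`:
-- `1` if `v = 0` and `−1` if `v = 1`.
open Classical in
noncomputable def sgnF {F : Type*} [Zero F] (v : F) : ℤ :=
  if v = 0 then 1 else -1

-- `trF j x = Σ_{i=0}^{j−1} x^(2^i)`.
def trF {F : Type*} [Field F] (j : ℕ) (x : F) : F :=
  ∑ i ∈ Finset.range j, x ^ 2 ^ i

-- The cross correlation `C_d(τ) = Σ_{t=0}^{2^m−2} (−1)^{s_t + u_{d(t+τ)}}` between the
-- `m`-sequence `s_t = tr_m(α^t)` of period `2^m−1` and the `d`-decimation of the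
-- `m`-sequence `u_t = tr_n(β^t)` of period `2^n−1`, where `β = α^(2^n+1)`.
noncomputable def crossCorr {F : Type*} [Field F] (m n d : ℕ) (α : F) (τ : ℕ) : ℤ :=
  ∑ t ∈ Finset.range (2 ^ m - 1),
    sgnF (trF m (α ^ t) + trF n ((α ^ (2 ^ n + 1)) ^ (d * (t + τ))))

theorem coprime_two_pow_add_one_two_pow_sub_one_s3 {k r s : ℕ} (hkr : 0 < k * r) (hse : Even s)
    (hrs : Nat.gcd r s = 1) : Nat.Coprime (2 ^ (k * s) + 1) (2 ^ (2 * (k * r)) - 1) := by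
  set g := Nat.gcd (2 ^ (k * s) + 1) (2 ^ (2 * (k * r)) - 1) with hg
  have h1 : g ∣ 2 ^ (k * s) + 1 := Nat.gcd_dvd_left _ _
  have h2 : g ∣ 2 ^ (2 * (k * r)) - 1 := Nat.gcd_dvd_right _ _
  have h3 : g ∣ 2 ^ (2 * (k * s)) - 1 := by
    refine h1.trans ⟨2 ^ (k * s) - 1, ?_⟩
    rw [mul_comm 2 (k * s), pow_mul, ← Nat.sq_sub_sq, one_pow]
  have h4 : g ∣ 2 ^ (2 * k) - 1 := by
    have h := Nat.dvd_gcd h2 h3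
    rwa [Nat.pow_sub_one_gcd_pow_sub_one, ← mul_assoc, ← mul_assoc, Nat.gcd_mul_left, hrs,
      mul_one] at h
  have h5 : g ∣ 2 ^ (k * s) - 1 := by
    obtain ⟨c, rfl⟩ := hse
    refine h4.trans ?_
    rw [show k * (c + c) = 2 * k * c by ring]
    exact Nat.pow_sub_one_dvd_pow_sub_one 2 (dvd_mul_right _ _)
  have h6 : g ∣ 2 := by
    have h := Nat.dvd_sub h1 h5
    have : 1 ≤ 2 ^ (k * s) := Nat.one_le_two_pow
    rwa [show 2 ^ (k * s) + 1 - (2 ^ (k * s) - 1) = 2 by omega] at h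
  have hodd : ¬ 2 ∣ g := fun h => by
    have h7 := h.trans h2
    have h8 : 2 ∣ 2 ^ (2 * (k * r)) := dvd_pow_self 2 (by omega)
    have : 1 ≤ 2 ^ (2 * (k * r)) := Nat.one_le_two_pow
    omega
  rcases (Nat.dvd_prime Nat.prime_two).1 h6 with h | h
  · exact h
  · exact absurd (by rw [h]) hodd

theorem pow_two_pow_of_dvd {M : Type*} [Monoid M] {n j : ℕ} {z : M} (hz : z ^ 2 ^ n = z)
    (h : n ∣ j) : z ^ 2 ^ j = z := by
  obtain ⟨c, rfl⟩ := h
  induction c with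
  | zero => simp
  | succ c ih => rw [Nat.mul_succ, pow_add, pow_mul, ih, hz]

theorem trF_pow_two_pow {F : Type*} [Field F] {n : ℕ} {z : F} (hz : z ^ 2 ^ n = z) (i : ℕ) :
    trF n (z ^ 2 ^ i) = trF n z := by
  induction i with
  | zero => simp
  | succ i ih =>
    rw [← ih]
    have hw : (z ^ 2 ^ i) ^ 2 ^ n = z ^ 2 ^ i := by rw [pow_right_comm, hz]
    rw [pow_succ 2 i, pow_mul]
    generalize z ^ 2 ^ i = w at hw
    have h := Finset.sum_range_succ (fun j => w ^ 2 ^ j) n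
    rw [Finset.sum_range_succ', hw, pow_zero, pow_one] at h
    rw [trF, trF, ← add_right_cancel h]
    exact Finset.sum_congr rfl fun j _ => by rw [← pow_mul, ← pow_succ']

theorem dvd_sub_mod_mod_add {n : ℕ} (hn : 0 < n) (i : ℕ) : n ∣ (n - i % n) % n + i := by
  have hlt := Nat.mod_lt i hn
  rw [Nat.dvd_iff_mod_eq_zero, Nat.mod_add_mod, ← Nat.add_mod_mod, Nat.sub_add_cancel hlt.le,
    Nat.mod_self]

theorem pow_eq_pow_of_modEq_of_pow_eq_one {M : Type*} [Monoid M] {N a b : ℕ} {z : M}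
    (hz : z ^ N = 1) (h : a ≡ b [MOD N]) : z ^ a = z ^ b := by
  rw [← pow_mod_orderOf, ← pow_mod_orderOf z b, h.of_dvd (orderOf_dvd_of_pow_eq_one hz)]

theorem orderOf_eq_card_sub_one {F : Type*} [Field F] [Fintype F] {α : F} (hα0 : α ≠ 0)
    (hα : ∀ x : F, x ≠ 0 → ∃ j : ℕ, α ^ j = x) : orderOf α = Fintype.card F - 1 := by
  classical
  have h : orderOf (Units.mk0 α hα0) = Nat.card Fˣ := orderOf_eq_card_of_forall_mem_zpowers
    fun x => by
      obtain ⟨j, hj⟩ := hα x x.ne_zero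
      exact ⟨j, Units.ext (by simpa using hj)⟩
  rw [← Fintype.card_units, ← Nat.card_eq_fintype_card, ← h, ← orderOf_units, Units.val_mk0]

theorem sum_range_pow_eq_sum_ne_zero {F : Type*} [Field F] [Fintype F] [DecidableEq F] {α : F}
    (hα0 : α ≠ 0) (hα : ∀ x : F, x ≠ 0 → ∃ j : ℕ, α ^ j = x) (f : F → ℤ) :
    ∑ t ∈ Finset.range (Fintype.card F - 1), f (α ^ t) = ∑ x : F with x ≠ 0, f x := by
  have ho := orderOf_eq_card_sub_one hα0 hα
  have hpos : 0 < Fintype.card F - 1 := Nat.sub_pos_of_lt Fintype.one_lt_card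
  refine Finset.sum_nbij (α ^ ·) (fun t _ => by simp [hα0]) ?_ ?_ fun _ _ => rfl
  · rw [← ho]
    intro a ha b hb h
    exact pow_injOn_Iio_orderOf (by simpa using ha) (by simpa using hb) h
  · intro x hx
    obtain ⟨j, rfl⟩ := hα x (by simpa using hx)
    exact ⟨j % (Fintype.card F - 1), by simpa using Nat.mod_lt _ hpos,
      by simp only [← ho, pow_mod_orderOf]⟩

theorem sum_ne_zero_comp_pow {F : Type*} [Field F] [Fintype F] [DecidableEq F] {e : ℕ}
    (he : Nat.Coprime e (Fintype.card F - 1)) (f : F → ℤ) :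
    ∑ y : F with y ≠ 0, f (y ^ e) = ∑ x : F with x ≠ 0, f x := by
  have hinj : Set.InjOn (fun y : F => y ^ e) (↑(univ.filter fun y : F => y ≠ 0) : Set F) := by
    intro a ha b hb h
    have ha' : a ≠ 0 := by simpa using ha
    have hb' : b ≠ 0 := by simpa using hb
    have h1 : (a / b) ^ e = 1 := by
      rw [div_pow, div_eq_one_iff_eq (pow_ne_zero _ hb')]
      exact h
    have h2 : (a / b) ^ (Fintype.card F - 1) = 1 :=
      FiniteField.pow_card_sub_one_eq_one _ (div_ne_zero ha' hb')
    have h3 := pow_gcd_eq_one.2 ⟨h1, h2⟩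
    rw [he.gcd_eq_one, pow_one] at h3
    exact (div_eq_one_iff_eq hb').1 h3
  have hmaps : Set.MapsTo (fun y : F => y ^ e) (↑(univ.filter fun y : F => y ≠ 0) : Set F)
      ↑(univ.filter fun y : F => y ≠ 0) := fun y hy => by
    have : y ≠ 0 := by simpa using hy
    simpa using fun h => absurd h this
  refine Finset.sum_nbij (· ^ e) hmaps hinj ?_ fun _ _ => rfl
  exact Finset.surjOn_of_injOn_of_card_le _ hmaps hinj le_rfl

theorem bijOn_pow_mul {M : Type*} [Monoid M] {β : M} {c : ℕ} (hβ : IsOfFinOrder β)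
    (hc : Nat.Coprime c (orderOf β)) :
    Set.BijOn (fun τ : ℕ => β ^ (c * τ)) {τ | τ < orderOf β} {x | ∃ j : ℕ, β ^ j = x} := by
  refine ⟨fun τ _ => ⟨_, rfl⟩, fun a ha b hb h => ?_, ?_⟩
  · have h' := Nat.ModEq.cancel_left_of_coprime hc.symm (hβ.pow_eq_pow_iff_modEq.1 h)
    exact Nat.ModEq.eq_of_lt_of_lt h' ha hb
  · rintro _ ⟨j, rfl⟩
    obtain ⟨y, hlt, hy⟩ := Nat.exists_mul_mod_eq_of_coprime j hc hβ.orderOf_pos.ne'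
    exact ⟨y, hlt, hβ.pow_eq_pow_iff_modEq.2 hy⟩

/-- With the standing notation (`n = kr`, `m = 2n`, `l = ks`, …),
let `d > 0` with `d(2^l+1) ≡ 2^i (mod 2^n−1)`.  For each shift `τ ≤ 2^n−2`, with
`a = (β^{dτ})^{2^{(n − i mod n) mod n}} ∈ F_{2^n}^*`, one has
`C_d(τ) = −1 + Σ_{y ∈ F} (−1)^{ρ_a(y)}` where
`ρ_a(y) = tr_m(y^{2^l+1}) + tr_n(a·y^{2^n+1})`; moreover `τ ↦ a` is a bijection from
`{0, …, 2^n−2}` onto `F_{2^n}^*`. -/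
theorem crossCorr_eq_neg_one_add_quadratic_sum
    (k r s n m l : ℕ) (hk : 1 ≤ k) (hr : 3 ≤ r) (hro : Odd r)
    (hn : n = k * r) (hm : m = 2 * n) (hl : l = k * s)
    (hse : Even s) (hs0 : 0 < s) (hsr : s < r) (hrs : Nat.gcd r s = 1)
    (F : Type) [Field F] [Fintype F] (hF : Fintype.card F = 2 ^ m)
    (α : F) (hα0 : α ≠ 0) (hα : ∀ x : F, x ≠ 0 → ∃ j : ℕ, α ^ j = x)
    (d i : ℕ) (hd : 0 < d)
    (hdi : d * (2 ^ l + 1) ≡ 2 ^ i [MOD 2 ^ n - 1]) :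
    (∀ τ : ℕ, τ ≤ 2 ^ n - 2 →
        crossCorr m n d α τ =
          -1 + ∑ y : F, sgnF (trF m (y ^ (2 ^ l + 1)) +
            trF n ((((α ^ (2 ^ n + 1)) ^ (d * τ)) ^ 2 ^ ((n - i % n) % n)) *
              y ^ (2 ^ n + 1)))) ∧
    Set.BijOn (fun τ : ℕ => ((α ^ (2 ^ n + 1)) ^ (d * τ)) ^ 2 ^ ((n - i % n) % n))
      {τ : ℕ | τ ≤ 2 ^ n - 2} {x : F | x ^ 2 ^ n = x ∧ x ≠ 0} := by
  have hn0 : 0 < n := hn ▸ Nat.mul_pos hk (by omega)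
  have hm1 : 2 ^ m - 1 = (2 ^ n + 1) * (2 ^ n - 1) := by
    rw [hm, mul_comm 2 n, pow_mul, ← Nat.sq_sub_sq, one_pow]
  have h2n : 2 ≤ 2 ^ n := Nat.le_self_pow hn0.ne' 2
  have hN : 0 < 2 ^ n - 1 := by omega
  have hcop : Nat.Coprime (2 ^ l + 1) (2 ^ m - 1) := by
    subst hm hn hl
    exact coprime_two_pow_add_one_two_pow_sub_one_s3 hn0 hse hrs
  have hoddq : Nat.Coprime 2 (2 ^ n - 1) := by
    rw [Nat.coprime_two_left, Nat.odd_sub' (by omega)]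
    simpa using (Nat.even_pow.2 ⟨even_two, hn0.ne'⟩)
  have hcopd : Nat.Coprime d (2 ^ n - 1) := by
    refine Nat.Coprime.coprime_mul_right (k := 2 ^ l + 1) ?_
    rw [Nat.Coprime, hdi.gcd_eq]
    exact hoddq.pow_left i
  set e := (n - i % n) % n with he
  have hei : n ∣ e + i := dvd_sub_mod_mod_add hn0 i
  have ho : orderOf α = 2 ^ m - 1 := hF ▸ orderOf_eq_card_sub_one hα0 hα
  have hoβ : orderOf (α ^ (2 ^ n + 1)) = 2 ^ n - 1 := by
    rw [orderOf_pow_of_dvd (by omega) (ho ▸ hm1 ▸ dvd_mul_right _ _), ho, hm1]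
    exact Nat.mul_div_cancel_left _ (by omega)
  have hnorm : ∀ x : F, x ≠ 0 → (x ^ (2 ^ n + 1)) ^ (2 ^ n - 1) = 1 := fun x hx => by
    rw [← pow_mul, ← hm1, ← hF]
    exact FiniteField.pow_card_sub_one_eq_one x hx
  have hfix : ∀ z : F, z ^ (2 ^ n - 1) = 1 → z ^ 2 ^ n = z := fun z hz => by
    rw [← Nat.sub_add_cancel (show 1 ≤ 2 ^ n by omega), pow_succ, hz, one_mul]
  refine ⟨fun τ _ => ?_, ?_⟩
  · classical
    set b := (α ^ (2 ^ n + 1)) ^ (d * τ) with hb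
    have hb1 : b ^ (2 ^ n - 1) = 1 := by rw [hb, pow_right_comm, hnorm α hα0, one_pow]
    have key : ∀ y : F, y ≠ 0 →
        trF n (b * ((y ^ (2 ^ l + 1)) ^ (2 ^ n + 1)) ^ d) = trF n (b ^ 2 ^ e * y ^ (2 ^ n + 1)) :=
      fun y hy => by
        have hz : (b ^ 2 ^ e * y ^ (2 ^ n + 1)) ^ (2 ^ n - 1) = 1 := by
          rw [mul_pow, pow_right_comm, hb1, one_pow, hnorm y hy, one_mul]
        rw [← trF_pow_two_pow (hfix _ hz) i, mul_pow, ← pow_mul b, ← pow_add,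
          pow_two_pow_of_dvd (hfix b hb1) hei, ← pow_eq_pow_of_modEq_of_pow_eq_one (hnorm y hy) hdi]
        congr 2
        ring
    have hC : crossCorr m n d α τ =
        ∑ x : F with x ≠ 0, sgnF (trF m x + trF n (b * (x ^ (2 ^ n + 1)) ^ d)) := by
      rw [← sum_range_pow_eq_sum_ne_zero hα0 hα, hF, crossCorr]
      refine Finset.sum_congr rfl fun t _ => ?_
      congr 3
      rw [hb]
      ring
    rw [hC, ← sum_ne_zero_comp_pow (hF ▸ hcop), Finset.filter_ne',
      ← Finset.add_sum_erase univ _ (Finset.mem_univ (0 : F))]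
    have h0 : sgnF (trF m ((0 : F) ^ (2 ^ l + 1)) + trF n (b ^ 2 ^ e * 0 ^ (2 ^ n + 1))) = 1 := by
      simp [trF, sgnF]
    rw [h0, neg_add_cancel_left]
    exact Finset.sum_congr rfl fun y hy => by rw [key y (Finset.ne_of_mem_erase hy)]
  · have hB := bijOn_pow_mul (β := α ^ (2 ^ n + 1)) (c := d * 2 ^ e)
      (orderOf_pos_iff.1 (hoβ ▸ hN))
      (hoβ ▸ hcopd.mul_left (hoddq.pow_left e))
    rw [hoβ] at hB
    convert hB using 1
    · funext τ
      rw [← pow_mul, mul_right_comm]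
    · ext τ
      simp only [Set.mem_ofPred_eq]
      omega
    · ext x
      simp only [Set.mem_ofPred_eq]
      constructor
      · rintro ⟨hx, hx0⟩
        obtain ⟨j, rfl⟩ := hα x hx0
        have h1 : (α ^ j) ^ (2 ^ n - 1) = 1 := by
          refine mul_right_cancel₀ hx0 ?_
          rw [← pow_succ, Nat.sub_add_cancel (by omega), hx, one_mul]
        rw [← pow_mul] at h1
        have h2 := orderOf_dvd_of_pow_eq_one h1
        rw [ho, hm1] at h2
        obtain ⟨c, rfl⟩ := Nat.dvd_of_mul_dvd_mul_right hN h2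
        exact ⟨c, (pow_mul _ _ _).symm⟩
      · rintro ⟨j, rfl⟩
        refine ⟨hfix _ ?_, pow_ne_zero _ (pow_ne_zero _ hα0)⟩
        rw [pow_right_comm, hnorm α hα0, one_pow]
end

section
/- For b ∈ F_{2^n}^*, define ρ_b(y) = tr_m(y^{2^l + 1}) + tr_n(b·y^{2^n + 1}). Then for all x, z ∈ F, the symplectic form of ρ_b satisfies ρ_b(x + z) + ρ_b(x) + ρ_b(z) = tr_m( z^{2^l} · ( x^{2^{2t}} + b^{2^l}·x^{2^t} + x ) ), where t = n + l. -/
open Finset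

theorem trF_add {F : Type*} [Field F] [CharP F 2] (j : ℕ) (x y : F) :
    trF j (x + y) = trF j x + trF j y := by
  simp only [trF, add_pow_char_pow, Finset.sum_add_distrib]

theorem trF_add_index {F : Type*} [Field F] (i j : ℕ) (x : F) :
    trF (i + j) x = trF i x + trF j (x ^ 2 ^ i) := by
  simp only [trF, Finset.sum_range_add, ← pow_mul, ← pow_add]

/-- The trace is invariant under Frobenius. -/
theorem trF_pow_two_pow_s4 {F : Type*} [Field F] {m : ℕ} {x : F} (hx : x ^ 2 ^ m = x) (j : ℕ) :
    trF m (x ^ 2 ^ j) = trF m x := by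
  have h₁ := trF_add_index j m x
  have h₂ := trF_add_index m j x
  rw [hx] at h₂
  rw [Nat.add_comm m j, h₁, add_comm (trF m x)] at h₂
  exact add_left_cancel h₂

/-- With the standing notation (`n = kr`, `m = 2n`, `l = ks`,
`t = n + l`, …), let `b ∈ F_{2^n}^*` and
`ρ_b(y) = tr_m(y^{2^l+1}) + tr_n(b·y^{2^n+1})`.  Then for all `x, z ∈ F`,
`ρ_b(x+z) + ρ_b(x) + ρ_b(z) = tr_m(z^{2^l}·(x^{2^{2t}} + b^{2^l}·x^{2^t} + x))`. -/
theorem symplectic_form_of_rho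
    (k r s n m l t : ℕ) (hk : 1 ≤ k) (hr : 3 ≤ r) (hro : Odd r)
    (hn : n = k * r) (hm : m = 2 * n) (hl : l = k * s)
    (hse : Even s) (hs0 : 0 < s) (hsr : s < r) (hrs : Nat.gcd r s = 1)
    (ht : t = n + l)
    (F : Type) [Field F] [Fintype F] (hF : Fintype.card F = 2 ^ m)
    (b : F) (hb0 : b ≠ 0) (hbn : b ^ 2 ^ n = b)
    (x z : F) :
    (trF m ((x + z) ^ (2 ^ l + 1)) + trF n (b * (x + z) ^ (2 ^ n + 1)))
      + (trF m (x ^ (2 ^ l + 1)) + trF n (b * x ^ (2 ^ n + 1)))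
      + (trF m (z ^ (2 ^ l + 1)) + trF n (b * z ^ (2 ^ n + 1)))
      = trF m (z ^ 2 ^ l * (x ^ 2 ^ (2 * t) + b ^ 2 ^ l * x ^ 2 ^ t + x)) := by
  have hm0 : m ≠ 0 := by
    rintro rfl
    have := Fintype.one_lt_card (α := F)
    simp [hF] at this
  have : Fact (Nat.Prime 2) := ⟨Nat.prime_two⟩
  have : CharP F 2 := charP_of_card_eq_prime_pow hF
  have hfrob (y : F) : y ^ 2 ^ m = y := hF ▸ FiniteField.pow_card y
  have hpolar (e : ℕ) : (x + z) ^ (2 ^ e + 1)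
      = x ^ (2 ^ e + 1) + z ^ (2 ^ e + 1) + (x ^ 2 ^ e * z + x * z ^ 2 ^ e) := by
    rw [pow_succ, add_pow_char_pow]
    ring
  have hconj : (b * x ^ 2 ^ n * z) ^ 2 ^ n = b * (x * z ^ 2 ^ n) := by
    rw [mul_pow, mul_pow, hbn, ← pow_mul, ← pow_add, ← two_mul, ← hm, hfrob, mul_assoc]
  have hnorm : trF n (b * (x ^ 2 ^ n * z)) + trF n (b * (x * z ^ 2 ^ n))
      = trF m (b * x ^ 2 ^ n * z) := by
    rw [hm, two_mul, trF_add_index, hconj, mul_assoc]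
  have hfst : trF m (z ^ 2 ^ l * x ^ 2 ^ (2 * t)) = trF m (x ^ 2 ^ l * z) := by
    rw [← trF_pow_two_pow_s4 (hfrob (x ^ 2 ^ l * z)) l, mul_pow, ← pow_mul, ← pow_add,
      show 2 * t = m + (l + l) by omega, pow_add 2 m, pow_mul, hfrob, mul_comm]
  have hsnd : trF m (z ^ 2 ^ l * (b ^ 2 ^ l * x ^ 2 ^ t)) = trF m (b * x ^ 2 ^ n * z) := by
    rw [← trF_pow_two_pow_s4 (hfrob (b * x ^ 2 ^ n * z)) l, mul_pow, mul_pow, ← pow_mul, ← pow_add,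
      ht, mul_comm]
  rw [hpolar, hpolar, mul_add, mul_add, mul_add, mul_add, mul_add]
  simp only [trF_add]
  rw [hfst, hsnd, ← hnorm, mul_comm (z ^ 2 ^ l) x]
  linear_combination (trF m (x ^ (2 ^ l + 1)) + trF m (z ^ (2 ^ l + 1))
    + trF n (b * x ^ (2 ^ n + 1)) + trF n (b * z ^ (2 ^ n + 1))) * CharTwo.two_eq_zero (R := F)
end

section
/- For every a ∈ F_{2^n}^*, the number of roots in F of g_a(y) = y^{2^t + 1} + a^{2^l}·y + 1 is either 0, 2, or 2^k + 1 (all such roots are automatically nonzero since g_a(0) = 1). -/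
/-- The fixed points of `x ↦ x ^ p ^ t` in the field with `p ^ m` elements form a set with
`p ^ gcd m t` elements. -/
theorem ncard_pow_pow_eq_self {F : Type*} [Field F] [Fintype F] {p m : ℕ} (hp : 1 < p)
    (hF : Fintype.card F = p ^ m) (t : ℕ) :
    {v : F | v ^ p ^ t = v}.ncard = p ^ Nat.gcd m t := by
  have hpos (j : ℕ) : 1 ≤ p ^ j := Nat.one_le_pow _ _ (by omega)
  have hset : {v : F | v ^ p ^ t = v} =
      insert 0 ((fun x : Fˣ => (x : F)) '' {x : Fˣ | x ^ (p ^ t - 1) = 1}) := by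
    ext v
    simp only [Set.mem_ofPred_eq, Set.mem_insert_iff, Set.mem_image]
    constructor
    · intro hv
      by_cases h0 : v = 0
      · exact Or.inl h0
      · refine Or.inr ⟨Units.mk0 v h0, ?_, rfl⟩
        ext
        apply mul_right_cancel₀ h0
        simp only [Units.val_pow_eq_pow_val, Units.val_mk0, Units.val_one, one_mul]
        rw [← pow_succ, Nat.sub_add_cancel (hpos t), hv]
    · rintro (rfl | ⟨x, hx, rfl⟩)
      · exact zero_pow (by have := hpos t; omega)
      · have h := congrArg (fun y : Fˣ => ((y * x : Fˣ) : F)) hx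
        simp only [← pow_succ, Nat.sub_add_cancel (hpos t), one_mul,
          Units.val_pow_eq_pow_val] at h
        exact h
  have hker : {x : Fˣ | x ^ (p ^ t - 1) = 1}.ncard = p ^ Nat.gcd m t - 1 := by
    have h := IsCyclic.card_powMonoidHom_ker (G := Fˣ) (p ^ t - 1)
    rw [Nat.card_units, Nat.card_eq_fintype_card (α := F), hF, Nat.pow_sub_one_gcd_pow_sub_one] at h
    exact h
  rw [hset, Set.ncard_insert_of_notMem, Set.ncard_image_of_injective _ Units.val_injective, hker,
    Nat.sub_add_cancel (hpos _)]
  rintro ⟨x, -, hx⟩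
  exact x.ne_zero hx

/-- Iterating `x ↦ x ^ q` on a fixed point. -/
theorem pow_pow_eq_self {M : Type*} [Monoid M] {x : M} {q : ℕ} (h : x ^ q = x) (j : ℕ) :
    x ^ q ^ j = x := by
  induction j with
  | zero => simp
  | succ j ih => rw [pow_succ, pow_mul, ih, h]

/-- In a quadratic extension of finite fields of characteristic two, every element of the
smaller field is the trace of an element of the larger one. -/
theorem exists_pow_add_self_eq {F : Type*} [Field F] [Fintype F] [CharP F 2] {n : ℕ}
    (hn : n ≠ 0) (hF : Fintype.card F = 2 ^ (2 * n)) {c : F} (hc : c ^ 2 ^ n = c) :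
    ∃ w : F, w ^ 2 ^ n + w = c := by
  obtain ⟨θ, hθ⟩ : ∃ θ : F, θ ^ 2 ^ n ≠ θ := by
    by_contra! h
    have hcard := ncard_pow_pow_eq_self one_lt_two hF n
    rw [Set.eq_univ_of_forall (s := {v : F | v ^ 2 ^ n = v}) h, Set.ncard_univ,
      Nat.card_eq_fintype_card, hF, Nat.gcd_eq_right (Dvd.intro_left 2 rfl)] at hcard
    have := Nat.pow_right_injective le_rfl hcard
    omega
  have he0 : θ ^ 2 ^ n + θ ≠ 0 := fun h => hθ (CharTwo.add_eq_zero.mp h)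
  have he : (θ ^ 2 ^ n + θ) ^ 2 ^ n = θ ^ 2 ^ n + θ := by
    have hθm : (θ ^ 2 ^ n) ^ 2 ^ n = θ := by
      rw [← pow_mul, ← pow_add, ← two_mul, ← hF, FiniteField.pow_card]
    rw [add_pow_char_pow, hθm, add_comm]
  refine ⟨c * θ / (θ ^ 2 ^ n + θ), ?_⟩
  rw [div_pow, mul_pow, hc, he, ← add_div, ← mul_add, mul_div_assoc, div_self he0, mul_one]

/-- If the `r`-th iterate of `x ↦ x ^ 2 ^ t` is `x ↦ x ^ 2 ^ n`, then every element of the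
form `w ^ 2 ^ n + w` is of the form `v ^ 2 ^ t + v`. -/
theorem exists_pow_add_self_eq_of_iterate {F : Type*} [Field F] [CharP F 2] {n r t : ℕ}
    (hiter : ∀ x : F, x ^ (2 ^ t) ^ r = x ^ 2 ^ n) (w : F) :
    ∃ v : F, v ^ 2 ^ t + v = w ^ 2 ^ n + w := by
  refine ⟨∑ i ∈ Finset.range r, w ^ (2 ^ t) ^ i, ?_⟩
  rw [sum_pow_char_pow, ← hiter w]
  have hstep (i : ℕ) : (w ^ (2 ^ t) ^ i) ^ 2 ^ t = w ^ (2 ^ t) ^ (i + 1) := by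
    rw [← pow_mul, ← pow_succ]
  simp only [hstep]
  have h := Finset.sum_range_sub (fun i => w ^ (2 ^ t) ^ i) r
  simpa [CharTwo.sub_eq_add, Finset.sum_add_distrib] using h

/-- A fixed point `y` of `x ↦ x ^ 2 ^ n` for which `z ^ 2 ^ t + y ^ 2 * z` has a nonzero root
admits a solution of `z ^ 2 ^ t + y ^ 2 * z + y = 0`. -/
theorem exists_affine_root {F : Type*} [Field F] [Fintype F] [CharP F 2] {n r t : ℕ}
    (hn : n ≠ 0) (hF : Fintype.card F = 2 ^ (2 * n))
    (hiter : ∀ x : F, x ^ (2 ^ t) ^ r = x ^ 2 ^ n) {y u : F} (hy : y ^ 2 ^ n = y) (hy0 : y ≠ 0)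
    (hu0 : u ≠ 0) (hu : u ^ 2 ^ t + y ^ 2 * u = 0) :
    ∃ z : F, z ^ 2 ^ t + y ^ 2 * z + y = 0 := by
  have hu' : u ^ 2 ^ t = y ^ 2 * u := CharTwo.add_eq_zero.mp hu
  have hun : u ^ 2 ^ n = u := by
    set x := u ^ 2 ^ n / u with hx
    have hxt : x ^ 2 ^ t = x := by
      rw [hx, div_pow, pow_right_comm, hu', mul_pow, pow_right_comm, hy,
        mul_div_mul_left _ _ (pow_ne_zero 2 hy0)]
    have hxn : x ^ 2 ^ n = x := by rw [← hiter, pow_pow_eq_self hxt]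
    have hum : (u ^ 2 ^ n) ^ 2 ^ n = u := by
      rw [← pow_mul, ← pow_add, ← two_mul, ← hF, FiniteField.pow_card]
    have hx0 : u ^ 2 ^ n ≠ 0 := pow_ne_zero _ hu0
    have hx1 : x ^ 2 = 1 := by
      rw [pow_two]
      nth_rewrite 1 [← hxn]
      rw [hx, div_pow, hum]
      field_simp
    have : x = 1 := by
      have h : (x + 1) ^ 2 = 0 := by rw [CharTwo.add_sq, hx1, one_pow, CharTwo.add_self_eq_zero]
      exact CharTwo.add_eq_zero.mp (pow_eq_zero_iff two_ne_zero |>.mp h)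
    rwa [hx, div_eq_one_iff_eq hu0] at this
  have hc : (y / u ^ 2 ^ t) ^ 2 ^ n = y / u ^ 2 ^ t := by
    rw [div_pow, hy, pow_right_comm, hun]
  obtain ⟨w, hw⟩ := exists_pow_add_self_eq hn hF hc
  obtain ⟨v, hv⟩ := exists_pow_add_self_eq_of_iterate hiter w
  refine ⟨u * v, ?_⟩
  have hut : u ^ 2 ^ t ≠ 0 := pow_ne_zero _ hu0
  rw [hw, eq_div_iff hut] at hv
  rw [mul_pow, CharTwo.add_eq_zero, ← mul_assoc, ← hu', ← mul_add, mul_comm]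
  exact hv

/-- The roots of `y ^ (2 ^ t + 1) + A * y + 1` other than a given root `y₀` correspond to the
solutions of an affine equation. -/
theorem ncard_roots_eq_ncard_affine_add_one {F : Type*} [Field F] [Finite F] [CharP F 2]
    {t : ℕ} {A y₀ : F} (hy₀ : y₀ ^ (2 ^ t + 1) + A * y₀ + 1 = 0) :
    {y : F | y ^ (2 ^ t + 1) + A * y + 1 = 0}.ncard =
      {z : F | z ^ 2 ^ t + y₀ ^ 2 * z + y₀ = 0}.ncard + 1 := by
  have h0 : y₀ ≠ 0 := by
    rintro rfl
    simp at hy₀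
  have hkey (w : F) : y₀ * ((y₀ + w) ^ (2 ^ t + 1) + A * (y₀ + w) + 1) =
      w * (y₀ * w ^ 2 ^ t + y₀ ^ 2 * w ^ (2 ^ t - 1) + 1) := by
    have hw : w ^ 2 ^ t = w ^ (2 ^ t - 1) * w := by
      rw [← pow_succ, Nat.sub_add_cancel Nat.one_le_two_pow]
    rw [pow_succ] at hy₀ ⊢
    rw [add_pow_char_pow]
    linear_combination (y₀ + w) * hy₀ + y₀ ^ 2 * hw + (-w) * CharTwo.two_eq_zero (R := F)
  have haff (z : F) (hz : z ≠ 0) : (y₀ + z⁻¹) ^ (2 ^ t + 1) + A * (y₀ + z⁻¹) + 1 = 0 ↔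
      z ^ 2 ^ t + y₀ ^ 2 * z + y₀ = 0 := by
    have hzt : z ^ 2 ^ t = z ^ (2 ^ t - 1) * z := by
      rw [← pow_succ, Nat.sub_add_cancel Nat.one_le_two_pow]
    have h : y₀ * ((y₀ + z⁻¹) ^ (2 ^ t + 1) + A * (y₀ + z⁻¹) + 1) * (z * z ^ 2 ^ t) =
        z ^ 2 ^ t + y₀ ^ 2 * z + y₀ := by
      rw [hkey, inv_pow, inv_pow, hzt]
      field_simp
      ring
    rw [← h]
    simp [h0, hz]
  have hset : {y : F | y ^ (2 ^ t + 1) + A * y + 1 = 0} =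
      insert y₀ ((fun z => y₀ + z⁻¹) '' {z : F | z ^ 2 ^ t + y₀ ^ 2 * z + y₀ = 0}) := by
    ext y
    simp only [Set.mem_ofPred_eq, Set.mem_insert_iff, Set.mem_image]
    constructor
    · intro hy
      by_cases hyy : y = y₀
      · exact Or.inl hyy
      · have hz : (y - y₀)⁻¹ ≠ 0 := inv_ne_zero (sub_ne_zero.mpr hyy)
        refine Or.inr ⟨(y - y₀)⁻¹, (haff _ hz).mp ?_, by simp⟩
        simpa using hy
    · rintro (rfl | ⟨z, hz, rfl⟩)
      · exact hy₀
      · refine (haff z ?_).mpr hz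
        rintro rfl
        simp [h0] at hz
  rw [hset, Set.ncard_insert_of_notMem, Set.ncard_image_of_injective]
  · intro z z' h
    simpa using h
  · rintro ⟨z, hz, h⟩
    have : z = 0 := by simpa using h
    subst this
    simp [h0] at hz

/-- For `b ≠ 0` the solution set of `z ^ 2 ^ t + b * z + c = 0` has `0`, `1` or `2 ^ gcd m t`
elements, and it is empty only if the homogeneous equation has a nonzero solution. -/
theorem ncard_affine_trichotomy {F : Type*} [Field F] [Fintype F] [CharP F 2] {m t : ℕ}
    (hF : Fintype.card F = 2 ^ m) {b c : F} (hb : b ≠ 0) :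
    ({z : F | z ^ 2 ^ t + b * z + c = 0} = ∅ ∧ ∃ u : F, u ≠ 0 ∧ u ^ 2 ^ t + b * u = 0) ∨
      {z : F | z ^ 2 ^ t + b * z + c = 0}.ncard = 1 ∨
      {z : F | z ^ 2 ^ t + b * z + c = 0}.ncard = 2 ^ Nat.gcd m t := by
  have hadd (x y : F) : (x + y) ^ 2 ^ t + b * (x + y) =
      (x ^ 2 ^ t + b * x) + (y ^ 2 ^ t + b * y) := by
    rw [add_pow_char_pow]
    ring
  by_cases hK : ∃ u : F, u ≠ 0 ∧ u ^ 2 ^ t + b * u = 0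
  · rcases Set.eq_empty_or_nonempty {z : F | z ^ 2 ^ t + b * z + c = 0} with hZ | ⟨z₀, hz₀⟩
    · exact Or.inl ⟨hZ, hK⟩
    · obtain ⟨u, hu0, hu⟩ := hK
      have hu' : u ^ 2 ^ t = b * u := CharTwo.add_eq_zero.mp hu
      refine Or.inr (Or.inr ?_)
      have hset : {z : F | z ^ 2 ^ t + b * z + c = 0} =
          (fun v => z₀ + u * v) '' {v : F | v ^ 2 ^ t = v} := by
        have hv (v : F) : (z₀ + u * v) ^ 2 ^ t + b * (z₀ + u * v) + c = 0 ↔ v ^ 2 ^ t = v := by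
          have h : (z₀ + u * v) ^ 2 ^ t + b * (z₀ + u * v) + c = b * u * (v ^ 2 ^ t + v) := by
            rw [hadd, mul_pow, hu']
            linear_combination hz₀.out
          rw [h, ← CharTwo.add_eq_zero (a := v ^ 2 ^ t)]
          simp only [mul_eq_zero, hb, hu0, false_or]
        ext z
        simp only [Set.mem_ofPred_eq, Set.mem_image]
        constructor
        · intro hz
          have hzv : z₀ + u * ((z - z₀) / u) = z := by
            field_simp
            ring
          exact ⟨(z - z₀) / u, (hv _).mp (by rwa [hzv]), hzv⟩
        · rintro ⟨v, hv', rfl⟩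
          exact (hv v).mpr hv'
      rw [hset, Set.ncard_image_of_injective, ncard_pow_pow_eq_self one_lt_two hF]
      intro v v' h
      simpa [hu0] using h
  · push Not at hK
    have hinj : Function.Injective (fun z : F => z ^ 2 ^ t + b * z) := by
      intro x y h
      by_contra hxy
      refine hK (x + y) (fun h' => hxy (CharTwo.add_eq_zero.mp h')) ?_
      rw [hadd]
      exact CharTwo.add_eq_zero.mpr h
    obtain ⟨z₀, hz₀⟩ := Finite.surjective_of_injective hinj c
    refine Or.inr (Or.inl (Set.ncard_eq_one.mpr ⟨z₀, ?_⟩))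
    ext z
    simp only [Set.mem_ofPred_eq, Set.mem_singleton_iff, CharTwo.add_eq_zero]
    exact ⟨fun h => hinj (h.trans hz₀.symm), fun h => h ▸ hz₀⟩

/-- With the standing notation (`n = kr`, `m = 2n`, `l = ks`,
`t = n + l`, …), for every `a ∈ F_{2^n}^*` the number of roots in `F` of
`g_a(y) = y^{2^t+1} + a^{2^l}·y + 1` is either `0`, `2`, or `2^k + 1`. -/
theorem card_roots_g_eq_zero_two_or_pow_add_one
    (k r s n m l t : ℕ) (hk : 1 ≤ k) (hr : 3 ≤ r) (hro : Odd r)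
    (hn : n = k * r) (hm : m = 2 * n) (hl : l = k * s)
    (hse : Even s) (hs0 : 0 < s) (hsr : s < r) (hrs : Nat.gcd r s = 1)
    (ht : t = n + l)
    (F : Type) [Field F] [Fintype F] (hF : Fintype.card F = 2 ^ m)
    (a : F) (ha0 : a ≠ 0) (han : a ^ 2 ^ n = a) :
    Nat.card {y : F | y ^ (2 ^ t + 1) + a ^ 2 ^ l * y + 1 = 0}
      ∈ ({0, 2, 2 ^ k + 1} : Set ℕ) := by
  have hn0 : n ≠ 0 := by
    rw [hn]
    positivity
  subst hm
  have : Fact (Nat.Prime 2) := ⟨Nat.prime_two⟩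
  have : CharP F 2 := charP_of_card_eq_prime_pow hF
  have hodd : Odd (r + s) := hro.add_even hse
  have hgcd : Nat.gcd (2 * n) t = k := by
    have hcop : Nat.Coprime (2 * r) (r + s) :=
      Nat.Coprime.mul_left (Nat.coprime_two_left.mpr hodd) (Nat.coprime_self_add_right.mpr hrs)
    rw [ht, hn, hl, ← mul_add, Nat.mul_left_comm, Nat.gcd_mul_left, hcop, mul_one]
  have hiter (x : F) : x ^ (2 ^ t) ^ r = x ^ 2 ^ n := by
    obtain ⟨j, hj⟩ := hodd
    have htr : t * r = 2 * n * j + n := by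
      rw [ht, hl, hn, ← mul_add, hj]
      ring
    rw [← pow_mul, htr, pow_add, pow_mul, pow_mul, ← hF, FiniteField.pow_card_pow]
  change {y : F | y ^ (2 ^ t + 1) + a ^ 2 ^ l * y + 1 = 0}.ncard ∈ _
  rcases Set.eq_empty_or_nonempty {y : F | y ^ (2 ^ t + 1) + a ^ 2 ^ l * y + 1 = 0}
    with hS | ⟨y, hy⟩
  · simp [hS]
  have hcard := ncard_roots_eq_ncard_affine_add_one hy
  have hy0 : y ≠ 0 := by
    rintro rfl
    simp at hy
  rcases ncard_affine_trichotomy (t := t) (c := y) hF (pow_ne_zero 2 hy0) with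
    ⟨hZ, u, hu0, hu⟩ | hZ | hZ
  · rw [hZ, Set.ncard_empty, zero_add, Set.ncard_eq_one] at hcard
    obtain ⟨y', hy'⟩ := hcard
    have hyn : y ^ 2 ^ n = y := by
      have hmem : y ^ 2 ^ n ∈ {y : F | y ^ (2 ^ t + 1) + a ^ 2 ^ l * y + 1 = 0} := by
        have h := congrArg (· ^ 2 ^ n) hy.out
        simp only [add_pow_char_pow, mul_pow, one_pow, zero_pow (pow_ne_zero n two_ne_zero)] at h
        rw [pow_right_comm y, pow_right_comm a, han] at h
        exact h
      rw [hy'] at hmem hy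
      rw [Set.mem_singleton_iff.mp hmem, Set.mem_singleton_iff.mp hy]
    obtain ⟨z, hz⟩ := exists_affine_root hn0 hF hiter hyn hy0 hu0 hu
    exact absurd (show z ∈ (∅ : Set F) from hZ ▸ hz) (Set.notMem_empty z)
  · simp [hcard, hZ]
  · simp [hcard, hZ, hgcd]
end

section
/- Let a ∈ F_{2^n}^*. If y₁ and y₂ are two distinct roots in F of g_a(y) = y^{2^t + 1} + a^{2^l}·y + 1, then the product y₁·y₂ is a (2^k − 1)-th power in F, i.e. there exists w ∈ F with y₁·y₂ = w^{2^k − 1}. -/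
/-- If `x ≠ y` are roots of `X ^ (p ^ t + 1) + b * X + 1` in characteristic `p`, then
`x * y * (x - y) ^ (p ^ t - 1) = 1`. -/
theorem mul_mul_sub_pow_eq_one_of_roots {K : Type*} [Field K] (p : ℕ) [Fact p.Prime] [CharP K p]
    (t : ℕ) (b : K) {x y : K} (hxy : x ≠ y)
    (hx : x ^ (p ^ t + 1) + b * x + 1 = 0) (hy : y ^ (p ^ t + 1) + b * y + 1 = 0) :
    x * y * (x - y) ^ (p ^ t - 1) = 1 := by
  have hpos : 0 < p ^ t := pow_pos (Fact.out : p.Prime).pos t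
  apply mul_right_cancel₀ (sub_ne_zero.mpr hxy)
  rw [mul_assoc, ← pow_succ, Nat.sub_add_cancel hpos, sub_pow_char_pow]
  rw [pow_succ] at hx hy
  linear_combination y * hx - x * hy

/-- With the standing notation (`n = kr`, `m = 2n`, `l = ks`,
`t = n + l`, …), let `a ∈ F_{2^n}^*`.  If `y₁` and `y₂` are two distinct roots in `F` of
`g_a(y) = y^{2^t+1} + a^{2^l}·y + 1`, then `y₁·y₂` is a `(2^k − 1)`-th power in `F`. -/
theorem product_of_distinct_roots_is_power
    (k r s n m l t : ℕ) (hk : 1 ≤ k) (hr : 3 ≤ r) (hro : Odd r)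
    (hn : n = k * r) (hm : m = 2 * n) (hl : l = k * s)
    (hse : Even s) (hs0 : 0 < s) (hsr : s < r) (hrs : Nat.gcd r s = 1)
    (ht : t = n + l)
    (F : Type) [Field F] [Fintype F] (hF : Fintype.card F = 2 ^ m)
    (a : F) (ha0 : a ≠ 0) (han : a ^ 2 ^ n = a)
    (y₁ y₂ : F) (hne : y₁ ≠ y₂)
    (h1 : y₁ ^ (2 ^ t + 1) + a ^ 2 ^ l * y₁ + 1 = 0)
    (h2 : y₂ ^ (2 ^ t + 1) + a ^ 2 ^ l * y₂ + 1 = 0) :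
    ∃ w : F, y₁ * y₂ = w ^ (2 ^ k - 1) := by
  have hm0 : m ≠ 0 := by
    have := Nat.mul_pos hk (by omega : 0 < r)
    omega
  have : Fact (Nat.Prime 2) := ⟨Nat.prime_two⟩
  have : CharP F 2 := by
    refine CharTwo.of_one_ne_zero_of_two_eq_zero one_ne_zero ?_
    have h := FiniteField.cast_card_eq_zero F
    rw [hF] at h
    push_cast at h
    exact (pow_eq_zero_iff hm0).mp h
  obtain ⟨q, hq⟩ : 2 ^ k - 1 ∣ 2 ^ t - 1 :=
    Nat.pow_sub_one_dvd_pow_sub_one 2 ⟨r + s, by rw [ht, hn, hl]; ring⟩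
  refine ⟨(y₁ - y₂)⁻¹ ^ q, ?_⟩
  rw [← pow_mul, mul_comm q, ← hq, inv_pow]
  exact eq_inv_of_mul_eq_one_left
    (mul_mul_sub_pow_eq_one_of_roots 2 t (a ^ 2 ^ l) hne h1 h2)
end

section
/- Let a ∈ F_{2^n}^*. If g_a(y) = y^{2^t + 1} + a^{2^l}·y + 1 has at least three distinct roots in F, then every root of g_a in F is a (2^k − 1)-th power in F. -/
/-- If `σ` is an endomorphism of a commutative ring of characteristic two, and `y σ(y) + b y + 1 = 0`,
then the vector `(y, 1)` is mapped by the `i`-th semilinear power of the matrix `!![b, 1; 1, 0]` to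
`∏_{j < i} σ^j(y)` times `(σ^i(y), 1)`; this matrix has determinant one. -/
lemma exists_iterate_coeffs {R : Type*} [CommRing R] [CharP R 2] (Q : ℕ)
    (hQ : ∀ x y : R, (x + y) ^ Q = x ^ Q + y ^ Q) (b : R) (i : ℕ) :
    ∃ p q u v : R, p * v + q * u = 1 ∧ ∀ y : R, y ^ (Q + 1) + b * y + 1 = 0 →
      p * y + q = (∏ j ∈ Finset.range i, y ^ Q ^ j) * y ^ Q ^ i ∧
      u * y + v = ∏ j ∈ Finset.range i, y ^ Q ^ j := by
  have hpow : ∀ (i : ℕ) (x y : R), (x + y) ^ Q ^ i = x ^ Q ^ i + y ^ Q ^ i := by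
    intro i
    induction i with
    | zero => simp
    | succ i ih => intro x y; simp only [pow_succ, pow_mul, ih, hQ]
  induction i with
  | zero => exact ⟨1, 0, 0, 1, by simp, by simp⟩
  | succ i ih =>
    obtain ⟨p, q, u, v, hdet, hroot⟩ := ih
    have two : (2 : R) = 0 := CharTwo.two_eq_zero
    refine ⟨b ^ Q ^ i * p + u, b ^ Q ^ i * q + v, p, q, ?_, fun y hy => ?_⟩
    · linear_combination hdet + b ^ Q ^ i * p * q * two
    · obtain ⟨h₁, h₂⟩ := hroot y hy
      have hy' : y ^ (Q + 1) = b * y + 1 := by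
        linear_combination hy - (b * y + 1) * two
      have key : y ^ Q ^ (i + 1) * y ^ Q ^ i = b ^ Q ^ i * y ^ Q ^ i + 1 := by
        have := congrArg (· ^ Q ^ i) hy'
        simp only [hpow, mul_pow, one_pow] at this
        rw [← this, ← pow_add, ← pow_mul]
        ring_nf
      rw [Finset.prod_range_succ]
      exact ⟨by linear_combination b ^ Q ^ i * h₁ + h₂ -
        (∏ j ∈ Finset.range i, y ^ Q ^ j) * key, h₁⟩

/-- A quadratic polynomial with three distinct roots in a domain vanishes. -/
lemma coeffs_eq_zero_of_three_roots {R : Type*} [CommRing R] [IsDomain R] {α β γ x y z : R}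
    (hxy : x ≠ y) (hxz : x ≠ z) (hyz : y ≠ z)
    (hx : α * x ^ 2 + β * x + γ = 0) (hy : α * y ^ 2 + β * y + γ = 0)
    (hz : α * z ^ 2 + β * z + γ = 0) : α = 0 ∧ β = 0 ∧ γ = 0 := by
  have h₁ : α * (x + y) + β = 0 :=
    mul_left_cancel₀ (sub_ne_zero.2 hxy) (by linear_combination hx - hy)
  have h₂ : α * (x + z) + β = 0 :=
    mul_left_cancel₀ (sub_ne_zero.2 hxz) (by linear_combination hx - hz)
  have hα : α = 0 := mul_left_cancel₀ (sub_ne_zero.2 hyz) (by linear_combination h₁ - h₂)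
  subst hα
  have hβ : β = 0 := by simpa using h₁
  subst hβ
  simpa using hx

/-- Multiplication by a unit permutes the residues modulo `d`. -/
lemma prod_range_mul_mod {M : Type*} [CommMonoid M] {c d : ℕ} (hcd : Nat.Coprime d c)
    (f : ℕ → M) :
    ∏ j ∈ Finset.range d, f (c * j % d) = ∏ j ∈ Finset.range d, f j := by
  rcases Nat.eq_zero_or_pos d with rfl | hd
  · simp
  have hmaps : Set.MapsTo (fun j => c * j % d) (Finset.range d) (Finset.range d) :=
    fun j _ => by simpa using Nat.mod_lt _ hd
  have hinj : Set.InjOn (fun j => c * j % d) (Finset.range d) := by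
    intro i hi j hj hij
    simp only [Finset.coe_range, Set.mem_Iio] at hi hj
    exact (Nat.ModEq.cancel_left_of_coprime hcd hij).eq_of_lt_of_lt hi hj
  exact Finset.prod_nbij (fun j => c * j % d) hmaps hinj
    (Finset.surjOn_of_injOn_of_card_le _ hmaps hinj le_rfl) fun _ _ => rfl

/-- In a finite field, an element killed by `D` is an `e`-th power when `D * e` is the order of the
unit group. -/
lemma exists_eq_pow_of_pow_eq_one {F : Type*} [Field F] [Fintype F] {D e : ℕ}
    (hDe : D * e = Fintype.card F - 1) {y : F} (hy : y ^ D = 1) : ∃ w : F, y = w ^ e := by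
  have hpos : 0 < D * e := hDe ▸ Nat.sub_pos_of_lt Fintype.one_lt_card
  have hD : 0 < D := Nat.pos_of_mul_pos_right hpos
  obtain ⟨g, hg⟩ := IsCyclic.exists_generator (α := Fˣ)
  have hord : orderOf g = D * e := by
    rw [orderOf_eq_card_of_forall_mem_zpowers hg, Nat.card_units, Nat.card_eq_fintype_card, hDe]
  have hyu : (Units.ofPowEqOne y D hy hD.ne') ^ D = 1 := Units.pow_ofPowEqOne hy hD.ne'
  obtain ⟨i, hi⟩ := mem_powers_iff_mem_zpowers.2 (hg (Units.ofPowEqOne y D hy hD.ne'))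
  simp only at hi
  rw [← hi, ← pow_mul, ← orderOf_dvd_iff_pow_eq_one, hord, mul_comm D] at hyu
  obtain ⟨j, rfl⟩ := Nat.dvd_of_mul_dvd_mul_right hD hyu
  refine ⟨(g : F) ^ j, ?_⟩
  have := congrArg (Units.val) hi
  simp only [Units.val_pow_eq_pow_val, Units.val_ofPowEqOne] at this
  rw [← this, ← pow_mul, mul_comm]


/-- With the standing notation (`n = kr`, `m = 2n`, `l = ks`,
`t = n + l`, …), let `a ∈ F_{2^n}^*`.  If `g_a(y) = y^{2^t+1} + a^{2^l}·y + 1` has at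
least three distinct roots in `F`, then every root of `g_a` in `F` is a `(2^k − 1)`-th
power in `F`. -/
theorem roots_are_powers_of_three_distinct_roots
    (k r s n m l t : ℕ) (hk : 1 ≤ k) (hr : 3 ≤ r) (hro : Odd r)
    (hn : n = k * r) (hm : m = 2 * n) (hl : l = k * s)
    (hse : Even s) (hs0 : 0 < s) (hsr : s < r) (hrs : Nat.gcd r s = 1)
    (ht : t = n + l)
    (F : Type) [Field F] [Fintype F] (hF : Fintype.card F = 2 ^ m)
    (a : F) (ha0 : a ≠ 0) (han : a ^ 2 ^ n = a)
    (y₁ y₂ y₃ : F) (h12 : y₁ ≠ y₂) (h13 : y₁ ≠ y₃) (h23 : y₂ ≠ y₃)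
    (hr1 : y₁ ^ (2 ^ t + 1) + a ^ 2 ^ l * y₁ + 1 = 0)
    (hr2 : y₂ ^ (2 ^ t + 1) + a ^ 2 ^ l * y₂ + 1 = 0)
    (hr3 : y₃ ^ (2 ^ t + 1) + a ^ 2 ^ l * y₃ + 1 = 0) :
    ∀ y : F, y ^ (2 ^ t + 1) + a ^ 2 ^ l * y + 1 = 0 →
      ∃ w : F, y = w ^ (2 ^ k - 1) := by
  intro y hy
  have : CharP F 2 := charP_of_card_eq_prime_pow (f := m) hF
  have : ExpChar F 2 := ExpChar.prime Nat.prime_two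
  have hfrob : ∀ (c i : ℕ) (x : F), x ^ 2 ^ (m * c + i) = x ^ 2 ^ i := by
    intro c i x
    rw [pow_add, pow_mul, pow_mul 2 m c, ← hF, FiniteField.pow_card_pow]
  have htk : t = k * (r + s) := by rw [ht, hn, hl]; ring
  have hmk : m = k * (2 * r) := by rw [hm, hn]; ring
  have hiter : ∀ x : F, x ^ (2 ^ t) ^ (2 * r) = x := by
    intro x
    have h := hfrob (r + s) 0 x
    rw [pow_zero, pow_one] at h
    rw [← pow_mul, show t * (2 * r) = m * (r + s) + 0 by rw [htk, hmk]; ring, h]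
  obtain ⟨p, q, u, v, hdet, hroot⟩ := exists_iterate_coeffs (2 ^ t)
    (fun x y : F => add_pow_expChar_pow x y 2 t) (a ^ 2 ^ l) (2 * r)
  have hquad : ∀ z : F, z ^ (2 ^ t + 1) + a ^ 2 ^ l * z + 1 = 0 →
      u * z ^ 2 + (v - p) * z + -q = 0 := by
    intro z hz
    obtain ⟨h₁, h₂⟩ := hroot z hz
    rw [hiter, ← h₂] at h₁
    linear_combination -h₁
  obtain ⟨hu, hvp, hq⟩ := coeffs_eq_zero_of_three_roots h12 h13 h23
    (hquad _ hr1) (hquad _ hr2) (hquad _ hr3)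
  have hv : v = 1 := by
    have hv2 : v ^ 2 = 1 := by linear_combination hdet + v * hvp - q * hu
    have hsq : (v - 1) ^ 2 = 0 := by
      linear_combination hv2 + (1 - v) * (CharTwo.two_eq_zero : (2 : F) = 0)
    exact sub_eq_zero.1 (pow_eq_zero_iff two_ne_zero |>.1 hsq)
  have hnorm : ∏ j ∈ Finset.range (2 * r), y ^ (2 ^ t) ^ j = 1 := by
    rw [← (hroot y hy).2, hu, hv]; ring
  have hcop : Nat.Coprime (2 * r) (r + s) := by
    refine Nat.Coprime.mul_left ?_ ?_
    · exact (Nat.coprime_two_left).2 (hro.add_even hse)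
    · simpa using hrs
  have hperm : ∏ j ∈ Finset.range (2 * r), y ^ (2 ^ t) ^ j =
      ∏ j ∈ Finset.range (2 * r), y ^ (2 ^ k) ^ j := by
    rw [← prod_range_mul_mod hcop fun j => y ^ (2 ^ k) ^ j]
    refine Finset.prod_congr rfl fun j _ => ?_
    rw [← pow_mul, ← pow_mul, ← hfrob ((r + s) * j / (2 * r)) (k * _), htk, hmk, mul_assoc,
      mul_assoc k, ← mul_add, Nat.div_add_mod]
  rw [hperm, Finset.prod_pow_eq_pow_sum] at hnorm
  refine exists_eq_pow_of_pow_eq_one ?_ hnorm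
  rw [Nat.geomSum_eq (Nat.le_self_pow (by omega) 2), ← pow_mul, hF, hmk]
  refine Nat.div_mul_cancel ?_
  rw [pow_mul]
  exact Nat.sub_one_dvd_pow_sub_one _ _
end

section
/- For every a ∈ F_{2^n}^*, the number of roots in F of f_a(x) = x^{2^{2t}} + a^{2^l}·x^{2^t} + x is exactly 1 or exactly 2^{2k}. Moreover, N(f_a, F) = 1 if and only if N(g_a, F) ∈ {0, 2}, and N(f_a, F) = 2^{2k} if and only if N(g_a, F) = 2^k + 1, where g_a(y) = y^{2^t + 1} + a^{2^l}·y + 1. -/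
/-- Over a finite field of size `q ^ m`, the fixed points of `x ↦ x ^ q ^ t` form a subfield with
`q ^ gcd m t` elements. -/
theorem ncard_pow_eq_self_of_card_eq_pow {F : Type*} [Field F] [Fintype F] {q m : ℕ}
    (hq : 0 < q) (hF : Fintype.card F = q ^ m) (t : ℕ) :
    {x : F | x ^ q ^ t = x}.ncard = q ^ Nat.gcd m t := by
  have hqt : 0 < q ^ t := pow_pos hq t
  have hset : {x : F | x ^ q ^ t = x} =
      insert 0 ((fun u : Fˣ => (u : F)) '' ((powMonoidHom (q ^ t - 1) : Fˣ →* Fˣ).ker : Set Fˣ)) := by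
    ext x
    simp only [Set.mem_ofPred_eq, Set.mem_insert_iff, Set.mem_image, SetLike.mem_coe,
      MonoidHom.mem_ker, powMonoidHom_apply]
    constructor
    · intro hx
      rcases eq_or_ne x 0 with h0 | h0
      · exact Or.inl h0
      · refine Or.inr ⟨Units.mk0 x h0, ?_, rfl⟩
        ext
        rw [Units.val_pow_eq_pow_val, Units.val_mk0, Units.val_one]
        apply mul_right_cancel₀ h0
        rw [← pow_succ, Nat.sub_add_cancel hqt, hx, one_mul]
    · rintro (rfl | ⟨u, hu, rfl⟩)
      · exact zero_pow hqt.ne'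
      · have := congrArg (fun v : Fˣ => (v : F)) hu
        simp only [Units.val_pow_eq_pow_val, Units.val_one] at this
        calc (u : F) ^ q ^ t = (u : F) ^ (q ^ t - 1) * u := by
              rw [← pow_succ, Nat.sub_add_cancel hqt]
          _ = u := by rw [this, one_mul]
  have hzero : (0 : F) ∉
      (fun u : Fˣ => (u : F)) '' ((powMonoidHom (q ^ t - 1) : Fˣ →* Fˣ).ker : Set Fˣ) := by
    rintro ⟨u, -, hu⟩
    exact u.ne_zero hu
  rw [hset, Set.ncard_insert_of_notMem hzero, Set.ncard_image_of_injective _ Units.val_injective,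
    ← Nat.card_coe_set_eq, SetLike.coe_sort_coe, IsCyclic.card_powMonoidHom_ker, Nat.card_units,
    Nat.card_eq_fintype_card, hF, Nat.pow_sub_one_gcd_pow_sub_one,
    Nat.sub_add_cancel (pow_pos hq _)]

section Semilinear

variable {F : Type*} [Field F] [CharP F 2] (σ : F →+* F)

/-- A telescoping solution of `σ u + u = σ^r v + v`. -/
theorem map_sum_iterate_add_sum_iterate (r : ℕ) (v : F) :
    σ (∑ i ∈ Finset.range r, σ^[i] v) + ∑ i ∈ Finset.range r, σ^[i] v = σ^[r] v + v := by
  induction r with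
  | zero => simp [CharTwo.add_self_eq_zero]
  | succ r ih =>
    have h2 : (2 : F) = 0 := CharTwo.two_eq_zero
    rw [Finset.sum_range_succ, map_add, Function.iterate_succ_apply' σ r v]
    linear_combination ih + σ^[r] v * h2

/-- If the `r`-th iterate of `σ` is a nontrivial involution, then every element fixed by that
iterate has the form `σ u + u`. -/
theorem exists_map_add_self_eq {r : ℕ} (hinv : ∀ x, σ^[r] (σ^[r] x) = x)
    {w : F} (hw : σ^[r] w ≠ w) {b : F} (hb : σ^[r] b = b) : ∃ u, σ u + u = b := by
  rw [← RingHom.coe_pow] at hinv hw hb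
  have hd : (σ ^ r) w + w ≠ 0 := fun h => hw (CharTwo.add_eq_zero.mp h)
  refine ⟨_, (map_sum_iterate_add_sum_iterate σ r (w * b / ((σ ^ r) w + w))).trans ?_⟩
  rw [← RingHom.coe_pow, map_div₀, map_mul, map_add, hinv, hb, add_comm w]
  field_simp

theorem ncard_map_add_self_eq {b u : F} (hu : σ u + u = b) :
    {z | σ z + z = b}.ncard = {e | σ e = e}.ncard := by
  have h2 : (2 : F) = 0 := CharTwo.two_eq_zero
  have : {z | σ z + z = b} = (fun e => e + u) '' {e | σ e = e} := by
    ext z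
    constructor
    · intro hz
      refine ⟨z + u, ?_, CharTwo.add_cancel_right z u⟩
      simp only [Set.mem_ofPred_eq, map_add] at hz ⊢
      linear_combination hz + hu + (b - z - u) * h2
    · rintro ⟨e, he, rfl⟩
      simp only [Set.mem_ofPred_eq, map_add] at he ⊢
      linear_combination he + hu + e * h2
  rw [this, Set.ncard_image_of_injective _ (add_left_injective u)]

variable {σ} {c : F}

/-- The roots of `y σ(y) + c y + 1` other than a given root `y₀` are the `y₀ + z⁻¹` with
`σ z + y₀² z + y₀ = 0`. -/
theorem ncard_riccati_roots [Finite F] {y₀ : F} (h : σ y₀ * y₀ + c * y₀ + 1 = 0) :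
    {y | σ y * y + c * y + 1 = 0}.ncard = {z | σ z + y₀ ^ 2 * z + y₀ = 0}.ncard + 1 := by
  have h2 : (2 : F) = 0 := CharTwo.two_eq_zero
  have hy₀ : y₀ ≠ 0 := by rintro rfl; simp at h
  have hz₀ : ∀ z, σ z + y₀ ^ 2 * z + y₀ = 0 → z ≠ 0 := by
    rintro z hz rfl; simp [hy₀] at hz
  have hset : {y | σ y * y + c * y + 1 = 0} =
      insert y₀ ((fun z => y₀ + z⁻¹) '' {z | σ z + y₀ ^ 2 * z + y₀ = 0}) := by
    ext y
    simp only [Set.mem_insert_iff, Set.mem_image, Set.mem_ofPred_eq]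
    constructor
    · intro hy
      rcases eq_or_ne y y₀ with hne | hne
      · exact Or.inl hne
      · have hd : y + y₀ ≠ 0 := fun h0 => hne (CharTwo.add_eq_zero.mp h0)
        have hσd : σ y + σ y₀ ≠ 0 := by rw [← map_add]; exact (map_ne_zero σ).mpr hd
        refine Or.inr ⟨(y + y₀)⁻¹, ?_, ?_⟩
        · rw [map_inv₀, map_add]
          field_simp
          grind
        · rw [inv_inv]; linear_combination y₀ * h2
    · rintro (rfl | ⟨z, hz, rfl⟩)
      · exact h
      · have hz0 := hz₀ z hz
        have hσz : σ z ≠ 0 := (map_ne_zero σ).mpr hz0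
        rw [map_add, map_inv₀]
        field_simp
        grind
  rw [hset, Set.ncard_insert_of_notMem, Set.InjOn.ncard_image]
  · intro z _ z' _ hzz
    exact inv_injective (add_left_cancel hzz)
  · rintro ⟨z, hz, hzy⟩
    exact hz₀ z hz (by simpa using hzy)

/-- If `σ² + c σ + 1` is injective, the Riccati equation has no root or exactly two. -/
theorem ncard_riccati_roots_of_injective [Finite F]
    (hinj : ∀ x, σ (σ x) + c * σ x + x = 0 → x = 0) :
    {y | σ y * y + c * y + 1 = 0}.ncard = 0 ∨ {y | σ y * y + c * y + 1 = 0}.ncard = 2 := by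
  have h2 : (2 : F) = 0 := CharTwo.two_eq_zero
  rcases Set.eq_empty_or_nonempty {y | σ y * y + c * y + 1 = 0} with he | ⟨y₀, hy₀⟩
  · exact Or.inl (by rw [he, Set.ncard_empty])
  refine Or.inr ?_
  rw [ncard_riccati_roots hy₀]
  have hker : ∀ z, σ z + y₀ ^ 2 * z = 0 → z = 0 := by
    intro z hz
    obtain ⟨w, rfl⟩ : ∃ w, w ^ 2 = z :=
      Finite.injective_iff_surjective.mp (CharTwo.sq_injective (R := F)) z
    rw [map_pow, ← mul_pow, CharTwo.add_eq_zero] at hz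
    have hw : σ w = y₀ * w := CharTwo.sq_injective hz
    have hy₀' : σ y₀ * y₀ + c * y₀ + 1 = 0 := hy₀
    rw [hinj w (by rw [hw, map_mul, hw]; linear_combination w * hy₀'), zero_pow two_ne_zero]
  let D : F →+ F := σ.toAddMonoidHom + AddMonoidHom.mulLeft (y₀ ^ 2)
  have hD : ∀ z, D z = σ z + y₀ ^ 2 * z := fun z => rfl
  have hDinj : Function.Injective D := (injective_iff_map_eq_zero D).mpr hker
  obtain ⟨z₀, hz₀⟩ := Finite.injective_iff_surjective.mp hDinj y₀
  have : {z | σ z + y₀ ^ 2 * z + y₀ = 0} = {z₀} := by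
    ext z
    rw [Set.mem_ofPred_eq, ← hD, CharTwo.add_eq_zero, ← hz₀, hDinj.eq_iff, Set.mem_singleton_iff]
  rw [this, Set.ncard_singleton]

/-- With a nonzero root `x₀` of `σ² + c σ + 1` and a solution of `σ u + u = (x₀ σ(x₀))⁻¹`, the
Riccati equation has one more root than the fixed field of `σ` has elements. -/
theorem ncard_riccati_roots_of_root [Finite F] {x₀ u : F} (hx₀ : x₀ ≠ 0)
    (h : σ (σ x₀) + c * σ x₀ + x₀ = 0) (hu : σ u + u = (x₀ * σ x₀)⁻¹) :
    {y | σ y * y + c * y + 1 = 0}.ncard = {e | σ e = e}.ncard + 1 := by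
  have hσ : σ x₀ ≠ 0 := (map_ne_zero σ).mpr hx₀
  have hy₀ : σ (σ x₀ / x₀) * (σ x₀ / x₀) + c * (σ x₀ / x₀) + 1 = 0 := by
    rw [map_div₀]
    field_simp
    linear_combination h
  rw [ncard_riccati_roots hy₀, ← ncard_map_add_self_eq σ hu]
  congr 1
  have hset : {z | σ z + (σ x₀ / x₀) ^ 2 * z + σ x₀ / x₀ = 0} =
      (fun z => x₀ ^ 2 * z) '' {z | σ z + z = (x₀ * σ x₀)⁻¹} := by
    ext z
    constructor
    · intro hz
      refine ⟨z / x₀ ^ 2, ?_, by field_simp⟩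
      simp only [Set.mem_ofPred_eq, map_div₀, map_pow] at hz ⊢
      field_simp at hz ⊢
      rw [← CharTwo.add_eq_zero]
      linear_combination hz
    · rintro ⟨z, hz, rfl⟩
      simp only [Set.mem_ofPred_eq, map_mul, map_pow] at hz ⊢
      field_simp at hz ⊢
      rw [← CharTwo.add_eq_zero] at hz
      linear_combination σ x₀ * hz
  rw [hset, Set.ncard_image_of_injective _ (mul_right_injective₀ (pow_ne_zero 2 hx₀))]

/-- With a nonzero root `x₀` of `σ² + c σ + 1` and a solution of `σ u + u = (x₀ σ(x₀))⁻¹`, the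
kernel of `σ² + c σ + 1` is two-dimensional over the fixed field of `σ`. -/
theorem ncard_ker_of_root {x₀ u : F} (hx₀ : x₀ ≠ 0)
    (h : σ (σ x₀) + c * σ x₀ + x₀ = 0) (hu : σ u + u = (x₀ * σ x₀)⁻¹) :
    {x | σ (σ x) + c * σ x + x = 0}.ncard = {e | σ e = e}.ncard ^ 2 := by
  have h2 : (2 : F) = 0 := CharTwo.two_eq_zero
  have hσ : σ x₀ ≠ 0 := (map_ne_zero σ).mpr hx₀
  have hσσ : σ (σ x₀) ≠ 0 := (map_ne_zero σ).mpr hσ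
  have hu' : (σ u + u) * (x₀ * σ x₀) = 1 := by
    rw [hu]; exact inv_mul_cancel₀ (mul_ne_zero hx₀ hσ)
  have hb : (x₀ * σ x₀)⁻¹ ≠ 0 := inv_ne_zero (mul_ne_zero hx₀ hσ)
  have hset : {x | σ (σ x) + c * σ x + x = 0} =
      (fun p : F × F => x₀ * (p.1 * u + p.2)) '' ({e | σ e = e} ×ˢ {e | σ e = e}) := by
    ext x
    constructor
    · intro hx
      obtain ⟨v, rfl⟩ : ∃ v, x₀ * v = x := ⟨x / x₀, by field_simp⟩
      simp only [Set.mem_ofPred_eq, map_mul] at hx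
      have hw : σ (σ x₀) * (σ (σ v) + σ v) = x₀ * (σ v + v) := by grind
      have he : σ ((σ v + v) * (x₀ * σ x₀)) = (σ v + v) * (x₀ * σ x₀) := by
        simp only [map_mul, map_add]
        linear_combination σ x₀ * hw
      refine ⟨((σ v + v) * (x₀ * σ x₀), v + (σ v + v) * (x₀ * σ x₀) * u), ⟨he, ?_⟩, ?_⟩
      · change σ (v + (σ v + v) * (x₀ * σ x₀) * u) = _
        rw [map_add, map_mul _ _ u, he]
        grind
      · grind
    · rintro ⟨⟨e, e'⟩, ⟨he, he'⟩, rfl⟩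
      simp only [Set.mem_ofPred_eq] at he he'
      have hu'' := congrArg σ hu'
      simp only [map_mul, map_add, map_one] at hu''
      simp only [Set.mem_ofPred_eq, map_mul, map_add, he, he']
      have hw : σ (σ x₀) * (σ (σ u) + σ u) = x₀ * (σ u + u) := by
        apply mul_left_cancel₀ hσ
        linear_combination hu'' - hu'
      grind
  rw [hset, Set.InjOn.ncard_image, Set.ncard_prod, sq]
  rintro ⟨e, e'⟩ ⟨he, he'⟩ ⟨d, d'⟩ ⟨hd, hd'⟩ hed
  simp only [Set.mem_ofPred_eq] at he he' hd hd'
  have h1 : e * u + e' = d * u + d' := mul_left_cancel₀ hx₀ hed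
  have h1' := congrArg σ h1
  simp only [map_add, map_mul, he, he', hd, hd'] at h1'
  have h3 : e * (x₀ * σ x₀)⁻¹ = d * (x₀ * σ x₀)⁻¹ := by
    rw [← hu]
    linear_combination h1 + h1' + (d' - e') * h2
  have hed : e = d := mul_right_cancel₀ hb h3
  subst hed
  rw [add_left_cancel h1]

end Semilinear


/-- With the standing notation (`n = kr`, `m = 2n`, `l = ks`,
`t = n + l`, …), for every `a ∈ F_{2^n}^*` the number of roots in `F` of
`f_a(x) = x^{2^{2t}} + a^{2^l}·x^{2^t} + x` is exactly `1` or exactly `2^{2k}`; moreover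
`N(f_a,F) = 1 ↔ N(g_a,F) ∈ {0,2}` and `N(f_a,F) = 2^{2k} ↔ N(g_a,F) = 2^k + 1`, where
`g_a(y) = y^{2^t+1} + a^{2^l}·y + 1`. -/
theorem card_roots_f_eq_one_or_pow
    (k r s n m l t : ℕ) (hk : 1 ≤ k) (hr : 3 ≤ r) (hro : Odd r)
    (hn : n = k * r) (hm : m = 2 * n) (hl : l = k * s)
    (hse : Even s) (hs0 : 0 < s) (hsr : s < r) (hrs : Nat.gcd r s = 1)
    (ht : t = n + l)
    (F : Type) [Field F] [Fintype F] (hF : Fintype.card F = 2 ^ m)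
    (a : F) (ha0 : a ≠ 0) (han : a ^ 2 ^ n = a) :
    (Nat.card {x : F | x ^ 2 ^ (2 * t) + a ^ 2 ^ l * x ^ 2 ^ t + x = 0} = 1 ∨
      Nat.card {x : F | x ^ 2 ^ (2 * t) + a ^ 2 ^ l * x ^ 2 ^ t + x = 0} = 2 ^ (2 * k)) ∧
    (Nat.card {x : F | x ^ 2 ^ (2 * t) + a ^ 2 ^ l * x ^ 2 ^ t + x = 0} = 1 ↔
      (Nat.card {y : F | y ^ (2 ^ t + 1) + a ^ 2 ^ l * y + 1 = 0} = 0 ∨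
        Nat.card {y : F | y ^ (2 ^ t + 1) + a ^ 2 ^ l * y + 1 = 0} = 2)) ∧
    (Nat.card {x : F | x ^ 2 ^ (2 * t) + a ^ 2 ^ l * x ^ 2 ^ t + x = 0} = 2 ^ (2 * k) ↔
      Nat.card {y : F | y ^ (2 ^ t + 1) + a ^ 2 ^ l * y + 1 = 0} = 2 ^ k + 1) := by
  subst hm
  have hn0 : 0 < n := hn ▸ Nat.mul_pos hk (by omega)
  have : CharP F 2 := charP_of_card_eq_prime_pow hF
  have hper : ∀ (j : ℕ) (x : F), x ^ 2 ^ (2 * n * j) = x := fun j x => by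
    rw [pow_mul, ← hF, FiniteField.pow_card_pow]
  let σ : F →+* F := iterateFrobenius F 2 t
  have hσ : ∀ x, σ x = x ^ 2 ^ t := fun x => rfl
  have hiter : ∀ (j : ℕ) (x : F), σ^[j] x = x ^ 2 ^ (t * j) := by
    intro j x
    induction j with
    | zero => simp
    | succ j ih => rw [Function.iterate_succ_apply', ih, hσ, ← pow_mul, ← pow_add, Nat.mul_succ]
  have hστ : ∀ x, σ^[r] x = x ^ 2 ^ n := by
    intro x
    obtain ⟨i, hi⟩ := hro
    obtain ⟨j, hj⟩ := hse
    have : t * r = 2 * n * (i + j) + n := by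
      rw [ht, hl, hn, hi, hj]; ring
    rw [hiter, this, pow_add, pow_mul, hper]
  have hinv : ∀ x, σ^[r] (σ^[r] x) = x := fun x => by
    rw [hστ, hστ, ← pow_mul, ← pow_add]
    simpa [two_mul] using hper 1 x
  have hgcd : Nat.gcd (2 * n) t = k := by
    have ht' : t = k * (r + s) := by rw [ht, hn, hl]; ring
    have hodd : Nat.Coprime 2 (r + s) := (Nat.coprime_two_left).mpr (hro.add_even hse)
    have hco : Nat.gcd (2 * r) (r + s) = 1 := by
      rw [hodd.gcd_mul_left_cancel r, Nat.gcd_self_add_right, hrs]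
    rw [ht', hn, show 2 * (k * r) = k * (2 * r) by ring, Nat.gcd_mul_left, hco, mul_one]
  have hK : {e | σ e = e}.ncard = 2 ^ k := by
    rw [← hgcd]
    exact ncard_pow_eq_self_of_card_eq_pow two_pos hF t
  obtain ⟨w, hw⟩ : ∃ w, σ^[r] w ≠ w := by
    by_contra! hall
    have hcard := ncard_pow_eq_self_of_card_eq_pow two_pos hF n
    have huniv : {x : F | x ^ 2 ^ n = x} = Set.univ :=
      Set.eq_univ_of_forall fun x => (hστ x).symm.trans (hall x)
    rw [huniv, Set.ncard_univ, Nat.card_eq_fintype_card, hF, Nat.gcd_mul_left_left] at hcard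
    have := Nat.pow_right_injective le_rfl hcard
    omega
  have hτc : (σ ^ r) (a ^ 2 ^ l) = a ^ 2 ^ l := by
    rw [map_pow, RingHom.coe_pow, hστ, han]
  have hf : {x : F | x ^ 2 ^ (2 * t) + a ^ 2 ^ l * x ^ 2 ^ t + x = 0} =
      {x | σ (σ x) + a ^ 2 ^ l * σ x + x = 0} := by
    ext x
    rw [Set.mem_ofPred_eq, Set.mem_ofPred_eq, hσ, hσ, ← pow_mul, ← pow_add, two_mul]
  have hg : {y : F | y ^ (2 ^ t + 1) + a ^ 2 ^ l * y + 1 = 0} =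
      {y | σ y * y + a ^ 2 ^ l * y + 1 = 0} := by
    ext y
    rw [Set.mem_ofPred_eq, Set.mem_ofPred_eq, hσ, pow_succ]
  rw [hf, hg, Nat.card_coe_set_eq, Nat.card_coe_set_eq]
  have hk2 : 2 ≤ 2 ^ k := Nat.le_self_pow (by omega) 2
  have hk4 : 2 ^ (2 * k) = (2 ^ k) ^ 2 := by rw [mul_comm, pow_mul]
  have hk5 : 1 < 2 ^ (2 * k) := by rw [hk4]; nlinarith
  by_cases hinj : ∀ x, σ (σ x) + a ^ 2 ^ l * σ x + x = 0 → x = 0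
  · have hone : {x | σ (σ x) + a ^ 2 ^ l * σ x + x = 0}.ncard = 1 := by
      rw [Set.ncard_eq_one]
      refine ⟨0, Set.eq_singleton_iff_unique_mem.mpr ⟨?_, hinj⟩⟩
      simp
    rcases ncard_riccati_roots_of_injective hinj with h | h <;> rw [hone, h] <;> omega
  · push Not at hinj
    obtain ⟨x, hx, hx0⟩ := hinj
    have hcomm : ∀ z, (σ ^ r) (σ z) = σ ((σ ^ r) z) := fun z => by
      rw [RingHom.coe_pow, ← Function.iterate_succ_apply, Function.iterate_succ_apply']
    rw [← RingHom.coe_pow] at hinv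
    obtain ⟨x₀, hx₀, hx₀0, hfix⟩ : ∃ x₀, σ (σ x₀) + a ^ 2 ^ l * σ x₀ + x₀ = 0 ∧ x₀ ≠ 0 ∧
        (σ ^ r) x₀ = x₀ := by
      rcases eq_or_ne ((σ ^ r) x + x) 0 with h0 | h0
      · exact ⟨x, hx, hx0, CharTwo.add_eq_zero.mp h0⟩
      · refine ⟨(σ ^ r) x + x, ?_, h0, ?_⟩
        · have hx' := congrArg (σ ^ r) hx
          simp only [map_add, map_mul, hτc, hcomm, map_zero] at hx'
          simp only [map_add]
          linear_combination hx + hx'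
        · rw [map_add, hinv, add_comm]
    obtain ⟨u, hu⟩ : ∃ u, σ u + u = (x₀ * σ x₀)⁻¹ := by
      rw [← RingHom.coe_pow] at hw
      refine exists_map_add_self_eq σ (r := r) ?_ (w := w) ?_ ?_ <;> rw [← RingHom.coe_pow]
      · exact hinv
      · exact hw
      · rw [map_inv₀, map_mul, hcomm, hfix]
    rw [ncard_ker_of_root hx₀0 hx₀ hu, ncard_riccati_roots_of_root hx₀0 hx₀ hu, hK, ← hk4]
    omega
end

section
/- Let m and t be positive integers, k = gcd(t, m), and let c be any element of F. Then the number of roots in F of the polynomial h_c(z) = z^{2^t + 1} + c·z + c is either 0, 1, 2, or 2^k + 1. -/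
section RingHomRoots

variable {K : Type*} [Field K] {φ : K →+* K} {c : K}

theorem map_sub_mul_of_roots {x y : K} (hx : φ x * x + c * x + c = 0)
    (hy : φ y * y + c * y + c = 0) : φ (x - y) * (x * y) = c * (x - y) := by
  rw [map_sub]
  linear_combination y * hx - x * hy

theorem ne_zero_of_root (hc : c ≠ 0) {x : K} (hx : φ x * x + c * x + c = 0) : x ≠ 0 := by
  rintro rfl
  simp at hx
  exact hc hx

/-- If `φ z * z + c * z + c` has three distinct roots, then, by taking cross-ratios with these, the
remaining ones are parametrized by the fixed points of `φ`. -/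
theorem ncard_roots_eq_ncard_fixed_add_one [Finite K] {a b d : K} (hab : a ≠ b) (had : a ≠ d)
    (hbd : b ≠ d) (ha : φ a * a + c * a + c = 0) (hb : φ b * b + c * b + c = 0)
    (hd : φ d * d + c * d + c = 0) :
    {z : K | φ z * z + c * z + c = 0}.ncard = {r : K | φ r = r}.ncard + 1 := by
  have hc : c ≠ 0 := by
    rintro rfl
    have key : ∀ x : K, φ x * x + 0 * x + 0 = 0 → x = 0 := by
      intro x hx
      simpa using hx
    exact hab ((key a ha).trans (key b hb).symm)
  have ha0 := ne_zero_of_root hc ha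
  have hb0 := ne_zero_of_root hc hb
  have hd0 := ne_zero_of_root hc hd
  have hda : d - a ≠ 0 := sub_ne_zero.2 had.symm
  have hdb : d - b ≠ 0 := sub_ne_zero.2 hbd.symm
  have hab' : a - b ≠ 0 := sub_ne_zero.2 hab
  have eda := map_sub_mul_of_roots hd ha
  have edb := map_sub_mul_of_roots hd hb
  have hden : ∀ r : K, φ r = r → r * (d - b) - (d - a) ≠ 0 := by
    intro r hr h
    have h1 : φ r * φ (d - b) - φ (d - a) = 0 := by
      rw [← map_mul, ← map_sub, h, map_zero]
    rw [hr] at h1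
    have h2 : c * (d - a) * (a - b) = 0 := by
      linear_combination (d * a * b) * h1 - r * a * edb + b * eda - c * a * h
    simp_all
  have hinj : Set.InjOn (fun r => (r * (d - b) * a - (d - a) * b) / (r * (d - b) - (d - a)))
      {r : K | φ r = r} := by
    intro r hr s hs h
    have h1 := hden r hr
    have h2 := hden s hs
    simp only at h
    rw [div_eq_div_iff h1 h2] at h
    have h3 : (r - s) * ((d - b) * (d - a) * (a - b)) = 0 := by
      linear_combination -h
    have h4 : (d - b) * (d - a) * (a - b) ≠ 0 := mul_ne_zero (mul_ne_zero hdb hda) hab'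
    exact sub_eq_zero.1 ((mul_eq_zero.1 h3).resolve_right h4)
  have hset : {z : K | φ z * z + c * z + c = 0} =
      insert a ((fun r => (r * (d - b) * a - (d - a) * b) / (r * (d - b) - (d - a))) ''
        {r : K | φ r = r}) := by
    ext z
    simp only [Set.mem_ofPred_eq, Set.mem_insert_iff, Set.mem_image]
    constructor
    · intro hz
      refine or_iff_not_imp_left.2 fun hza => ?_
      have hza' : z - a ≠ 0 := sub_ne_zero.2 hza
      have hz0 := ne_zero_of_root hc hz
      have eza := map_sub_mul_of_roots hz ha
      have ezb := map_sub_mul_of_roots hz hb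
      have hr : φ ((z - b) * (d - a) / ((z - a) * (d - b))) =
          (z - b) * (d - a) / ((z - a) * (d - b)) := by
        rw [map_div₀, map_mul, map_mul, eq_div_of_mul_eq (mul_ne_zero hz0 ha0) eza,
          eq_div_of_mul_eq (mul_ne_zero hz0 hb0) ezb, eq_div_of_mul_eq (mul_ne_zero hd0 ha0) eda,
          eq_div_of_mul_eq (mul_ne_zero hd0 hb0) edb]
        field_simp
      refine ⟨_, hr, ?_⟩
      rw [div_eq_iff (hden _ hr)]
      field_simp
      ring
    · rintro (rfl | ⟨r, hr, rfl⟩)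
      · exact ha
      · have h1 := hden r hr
        set w := (r * (d - b) * a - (d - a) * b) / (r * (d - b) - (d - a)) with hw
        have hw1 : w * (r * (d - b) - (d - a)) = r * (d - b) * a - (d - a) * b := by
          rw [hw, div_mul_cancel₀ _ h1]
        have hw2 := congrArg φ hw1
        simp only [map_mul, map_sub φ (_ * _), hr] at hw2
        have hden' : d * a * b * (r * φ (d - b) - φ (d - a)) =
            c * (w * (r * (d - b) - (d - a))) := by
          linear_combination r * a * edb - b * eda - c * hw1
        have hnum' : d * a * b * (φ w * (r * φ (d - b) - φ (d - a))) =
            -c ^ 2 * (w * (r * (d - b) - (d - a)) + (r * (d - b) - (d - a))) := by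
          linear_combination d * a * b * hw2 + r * a * φ a * edb - b * φ b * eda +
            c * r * (d - b) * ha - c * (d - a) * hb + c ^ 2 * hw1
        refine (mul_eq_zero.1 ?_).resolve_left (mul_ne_zero hc h1)
        linear_combination hnum' - φ w * hden'
  rw [hset, Set.ncard_insert_of_notMem, hinj.ncard_image]
  rintro ⟨r, hr, h⟩
  simp only at h
  rw [div_eq_iff (hden r hr)] at h
  have : (d - a) * (a - b) = 0 := by linear_combination h
  simp_all

end RingHomRoots

theorem FiniteField.ncard_pow_two_pow_eq_self (m t : ℕ) (F : Type*) [Field F] [Fintype F]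
    (hF : Fintype.card F = 2 ^ m) :
    {r : F | r ^ 2 ^ t = r}.ncard = 2 ^ Nat.gcd t m := by
  have hset : {r : F | r ^ 2 ^ t = r} = insert 0 ((fun u : Fˣ => (u : F)) ''
      ((powMonoidHom (2 ^ t - 1) : Fˣ →* Fˣ).ker : Set Fˣ)) := by
    ext r
    have hpow : r ^ 2 ^ t = r ^ (2 ^ t - 1) * r := by
      rw [← pow_succ, Nat.sub_add_cancel Nat.one_le_two_pow]
    simp only [Set.mem_ofPred_eq, Set.mem_insert_iff, Set.mem_image, SetLike.mem_coe,
      MonoidHom.mem_ker, powMonoidHom_apply]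
    constructor
    · intro h
      refine or_iff_not_imp_left.2 fun hr => ⟨Units.mk0 r hr, ?_, rfl⟩
      ext
      simpa [hpow, hr] using h
    · rintro (rfl | ⟨u, hu, rfl⟩)
      · simp
      · rw [hpow, ← Units.val_pow_eq_pow_val, hu, Units.val_one, one_mul]
  rw [hset, Set.ncard_insert_of_notMem (by simp), Set.ncard_image_of_injective _ Units.val_injective,
    ← Nat.card_coe_set_eq, SetLike.coe_sort_coe, IsCyclic.card_powMonoidHom_ker, Nat.card_units,
    Nat.card_eq_fintype_card, hF, Nat.pow_sub_one_gcd_pow_sub_one, Nat.gcd_comm,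
    Nat.sub_add_cancel Nat.one_le_two_pow]


/-- Let `m` and `t` be positive integers, `k = gcd(t, m)`, `F` the
field with `2^m` elements and `c ∈ F`.  Then the number of roots in `F` of
`h_c(z) = z^{2^t+1} + c·z + c` is either `0`, `1`, `2`, or `2^k + 1`. -/
theorem card_roots_h_mem
    (m t k : ℕ) (hm : 0 < m) (ht : 0 < t) (hk : k = Nat.gcd t m)
    (F : Type) [Field F] [Fintype F] (hF : Fintype.card F = 2 ^ m)
    (c : F) :
    Nat.card {z : F | z ^ (2 ^ t + 1) + c * z + c = 0}
      ∈ ({0, 1, 2, 2 ^ k + 1} : Set ℕ) := by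
  have : Fact (Nat.Prime 2) := ⟨Nat.prime_two⟩
  have : CharP F 2 := charP_of_card_eq_prime_pow hF
  have hroots : {z : F | z ^ (2 ^ t + 1) + c * z + c = 0} =
      {z : F | iterateFrobenius F 2 t z * z + c * z + c = 0} := by
    simp only [iterateFrobenius_def, pow_succ]
  rw [Nat.card_coe_set_eq, hroots]
  set S := {z : F | iterateFrobenius F 2 t z * z + c * z + c = 0} with hS
  by_cases h : 2 < S.ncard
  · obtain ⟨a, b, d, ha, hb, hd, hab, had, hbd⟩ := (Set.two_lt_ncard_iff S.toFinite).1 h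
    have hcard := ncard_roots_eq_ncard_fixed_add_one hab had hbd ha hb hd
    simp only [iterateFrobenius_def] at hcard
    rw [FiniteField.ncard_pow_two_pow_eq_self m t F hF, ← hk] at hcard
    simp [hS, iterateFrobenius_def, hcard]
  · simp only [Set.mem_insert_iff, Set.mem_singleton_iff]
    omega
end

section
/- Let n and t be positive integers, k = gcd(t, n), q = 2^k, and suppose μ = n/k is odd. For i ∈ {0, 1, 2, q + 1}, let N_i be the number of c ∈ K^* such that h_c(z) = z^{2^t + 1} + c·z + c has exactly i roots in K. Then every c ∈ K^* gives 0, 1, 2, or q + 1 roots, and: 2(q + 1)·N_0 = q^{μ+1} + q; N_1 = q^{μ−1} − 1; 2(q − 1)·N_2 = (q − 2)(q^μ − 1); and (q² − 1)·N_{q+1} = q^{μ−1} − 1. -/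
theorem Set.ncard_eq_sum_ncard_fiber {α β : Type*} [Finite α] {S : Set α} {T : Finset β}
    {f : α → β} (hf : ∀ a ∈ S, f a ∈ T) : S.ncard = ∑ b ∈ T, {a | a ∈ S ∧ f a = b}.ncard := by
  classical
  have := Fintype.ofFinite α
  rw [Set.ncard_eq_toFinset_card' S,
    Finset.card_eq_sum_card_fiberwise (f := f) (t := T) (by intro a; simpa using hf a)]
  refine Finset.sum_congr rfl fun b _ => ?_
  rw [Set.ncard_eq_toFinset_card']
  congr 1
  ext a
  simp

theorem Set.ncard_eq_mul_of_fiber {α β : Type*} [Finite α] [Finite β] {S : Set α} {T : Set β}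
    {f : α → β} {m : ℕ} (hf : ∀ a ∈ S, f a ∈ T)
    (h : ∀ b ∈ T, {a | a ∈ S ∧ f a = b}.ncard = m) : S.ncard = m * T.ncard := by
  rw [Set.ncard_eq_sum_ncard_fiber (T := T.toFinite.toFinset) (f := f) (by simpa using hf),
    Finset.sum_const_nat (m := m) (by simpa using h), Set.ncard_eq_toFinset_card T T.toFinite,
    mul_comm]

theorem Set.ncard_ne_zero_add_one {K : Type*} [Zero K] [Finite K] :
    {x : K | x ≠ 0}.ncard + 1 = Nat.card K := by
  rw [← Set.ncard_univ, ← Set.ncard_sdiff_singleton_add_one (Set.mem_univ (0 : K))]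
  congr 2
  ext u
  simp

theorem Set.ncard_sep_add_ncard_sep_not {α : Type*} [Finite α] (S : Set α) (p : α → Prop) :
    {a | a ∈ S ∧ p a}.ncard + {a | a ∈ S ∧ ¬ p a}.ncard = S.ncard :=
  Set.ncard_inter_add_ncard_sdiff_eq_ncard S {a | p a}

theorem FiniteField.ncard_pow_eq_one {K : Type*} [Field K] [Finite K] (d : ℕ) (hd : d ≠ 0) :
    {x : K | x ^ d = 1}.ncard = (Nat.card K - 1).gcd d := by
  have hinj : Function.Injective (Units.val : Kˣ → K) := Units.val_injective
  rw [← Nat.card_units, ← IsCyclic.card_powMonoidHom_ker Kˣ d, ← SetLike.coe_sort_coe,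
    Nat.card_coe_set_eq, ← Set.ncard_image_of_injective
      ((powMonoidHom d : Kˣ →* Kˣ).ker : Set Kˣ) hinj]
  congr 1
  ext x
  simp only [Set.mem_image, Set.mem_ofPred_eq, SetLike.mem_coe, MonoidHom.mem_ker,
    powMonoidHom_apply]
  constructor
  · intro h
    exact ⟨Units.ofPowEqOne x d h hd, by ext; simp, rfl⟩
  · rintro ⟨u, hu, rfl⟩
    rw [← Units.val_pow_eq_pow_val, hu, Units.val_one]

namespace Bluher

variable {K : Type*} [Field K]

/-- The zero set of `z ^ (Q + 1) + c * z + c`. -/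
def rootSet (Q : ℕ) (c : K) : Set K := {z | z ^ (Q + 1) + c * z + c = 0}

/-- The only parameter `c` for which a given `z` can be a root. -/
def param (Q : ℕ) (z : K) : K := z ^ (Q + 1) / (z + 1)

/-- The additive map `v ↦ v ^ Q + v`, for `Q` such that `x ↦ x ^ Q` is additive. -/
def frobeniusAddId (Q : ℕ) (hadd : ∀ x y : K, (x + y) ^ Q = x ^ Q + y ^ Q) : K →+ K :=
  AddMonoidHom.mk' (fun v => v ^ Q + v) fun x y => by rw [hadd]; ring

theorem frobeniusAddId_apply (Q : ℕ) (hadd : ∀ x y : K, (x + y) ^ Q = x ^ Q + y ^ Q) (v : K) :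
    frobeniusAddId Q hadd v = v ^ Q + v := rfl

theorem ncard_pow_eq [Finite K] {m r : ℕ} (hr : {x : K | x ^ m = 1}.ncard = r) {u : K}
    (hu : u ≠ 0) : {x : K | x ^ m = u ^ m}.ncard = r := by
  rw [← hr, ← Set.ncard_image_of_injective {x : K | x ^ m = 1} (mul_right_injective₀ hu)]
  congr 1
  ext x
  simp only [Set.mem_image, Set.mem_ofPred_eq]
  constructor
  · intro h
    refine ⟨x / u, ?_, by field_simp⟩
    rw [div_pow, h, div_self (pow_ne_zero _ hu)]
  · rintro ⟨y, hy, rfl⟩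
    rw [mul_pow, hy, mul_one]

theorem ncard_fiber_frobeniusAddId [Finite K] {Q q : ℕ}
    (hadd : ∀ x y : K, (x + y) ^ Q = x ^ Q + y ^ Q)
    (hker : Nat.card (frobeniusAddId Q hadd).ker = q) {a : K}
    (ha : a ∈ (frobeniusAddId Q hadd).range) : {v : K | v ^ Q + v = a}.ncard = q := by
  obtain ⟨v₀, rfl⟩ := ha
  rw [← hker, ← SetLike.coe_sort_coe, Nat.card_coe_set_eq,
    ← Set.ncard_image_of_injective ((frobeniusAddId Q hadd).ker : Set K)
      (add_right_injective v₀)]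
  congr 1
  ext v
  simp only [Set.mem_image, Set.mem_ofPred_eq, SetLike.mem_coe, AddMonoidHom.mem_ker,
    ← frobeniusAddId_apply Q hadd]
  constructor
  · intro h
    exact ⟨v - v₀, by rw [map_sub, h, sub_self], by ring⟩
  · rintro ⟨y, hy, rfl⟩
    rw [map_add, hy, add_zero]

section CharTwo

variable [CharP K 2]

theorem mem_rootSet_iff {Q : ℕ} {c z : K} (hc : c ≠ 0) :
    z ∈ rootSet Q c ↔ z ≠ 0 ∧ z ≠ 1 ∧ param Q z = c := by
  unfold rootSet param
  simp only [Set.mem_ofPred_eq]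
  constructor
  · intro h
    have h0 : z ≠ 0 := by rintro rfl; simp_all
    have h1 : z ≠ 1 := by
      rintro rfl
      have : (1 : K) + (c + c) = 0 := by simpa [add_assoc] using h
      simp [CharTwo.add_self_eq_zero] at this
    have h2 : z + 1 ≠ 0 := fun h => h1 (CharTwo.add_eq_zero.1 h)
    refine ⟨h0, h1, ?_⟩
    rw [div_eq_iff h2]
    linear_combination h - (c * z + c) * CharTwo.two_eq_zero (R := K)
  · rintro ⟨h0, h1, rfl⟩
    have h2 : z + 1 ≠ 0 := fun h => h1 (CharTwo.add_eq_zero.1 h)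
    linear_combination div_mul_cancel₀ (z ^ (Q + 1)) h2 + z ^ (Q + 1) * CharTwo.two_eq_zero (R := K)

theorem param_ne_zero {Q : ℕ} {z : K} (h0 : z ≠ 0) (h1 : z ≠ 1) : param Q z ≠ 0 :=
  div_ne_zero (pow_ne_zero _ h0) fun h => h1 (CharTwo.add_eq_zero.1 h)

theorem add_inv_mem_rootSet {Q : ℕ} (hadd : ∀ x y : K, (x + y) ^ Q = x ^ Q + y ^ Q)
    {z w : K} (h1 : z ≠ 1) (hw : w ≠ 0) :
    z + w⁻¹ ∈ rootSet Q (param Q z) ↔ z ^ Q * w ^ Q + z * (z + 1) * w = z + 1 := by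
  have h2 : z + 1 ≠ 0 := fun h => h1 (CharTwo.add_eq_zero.1 h)
  have key : ((z + w⁻¹) ^ (Q + 1) + param Q z * (z + w⁻¹) + param Q z) * ((z + 1) * w ^ (Q + 1)) =
      (z ^ Q * w ^ Q + z * (z + 1) * w) - (z + 1)
        + 2 * ((z + 1) + z ^ Q * w ^ Q * (z + z ^ 2 * w + w * z)) := by
    unfold param
    rw [pow_succ (z + w⁻¹), hadd, inv_pow]
    have := pow_ne_zero Q hw
    field_simp
    ring
  rw [CharTwo.two_eq_zero, zero_mul, add_zero] at key
  rw [← sub_eq_zero (b := z + 1), ← key]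
  unfold rootSet
  simp [h2, hw]

theorem ncard_rootSet_param [Finite K] {Q : ℕ} (hQ : Q ≠ 0)
    (hadd : ∀ x y : K, (x + y) ^ Q = x ^ Q + y ^ Q) {z : K} (h0 : z ≠ 0) (h1 : z ≠ 1) :
    (rootSet Q (param Q z)).ncard =
      {w : K | z ^ Q * w ^ Q + z * (z + 1) * w = z + 1}.ncard + 1 := by
  have h2 : z + 1 ≠ 0 := fun h => h1 (CharTwo.add_eq_zero.1 h)
  have hne {w : K} (hw : z ^ Q * w ^ Q + z * (z + 1) * w = z + 1) : w ≠ 0 := by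
    rintro rfl
    exact h2 (by simpa [hQ] using hw.symm)
  have hinj : Function.Injective fun w : K => z + w⁻¹ := fun a b h => by simpa using h
  have heq : rootSet Q (param Q z) = insert z ((fun w : K => z + w⁻¹) ''
      {w : K | z ^ Q * w ^ Q + z * (z + 1) * w = z + 1}) := by
    ext y
    simp only [Set.mem_insert_iff, Set.mem_image, Set.mem_ofPred_eq]
    constructor
    · intro hy
      refine or_iff_not_imp_left.2 fun hyz => ⟨(y - z)⁻¹, ?_, by simp⟩
      rw [← add_inv_mem_rootSet hadd h1 (inv_ne_zero (sub_ne_zero.2 hyz))]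
      simpa using hy
    · rintro (rfl | ⟨w, hw, rfl⟩)
      · exact (mem_rootSet_iff (param_ne_zero h0 h1)).2 ⟨h0, h1, rfl⟩
      · exact (add_inv_mem_rootSet hadd h1 (hne hw)).2 hw
  rw [heq, Set.ncard_insert_of_notMem, Set.ncard_image_of_injective _ hinj]
  rintro ⟨w, hw, h⟩
  exact hne hw (by simpa using h)

theorem ncard_rootSet_param_of_not_pow [Finite K] {Q : ℕ} (hQ : Q ≠ 0)
    (hadd : ∀ x y : K, (x + y) ^ Q = x ^ Q + y ^ Q) {z : K} (h0 : z ≠ 0) (h1 : z ≠ 1)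
    (hz : ¬ ∃ u : K, z + 1 = u ^ (Q - 1)) : (rootSet Q (param Q z)).ncard = 2 := by
  let L : K →+ K := AddMonoidHom.mk' (fun w => z ^ Q * w ^ Q + z * (z + 1) * w)
    fun x y => by rw [hadd]; ring
  have hL : Function.Injective L := by
    rw [injective_iff_map_eq_zero]
    intro w hw
    by_contra hw0
    refine hz ⟨z * w, ?_⟩
    have hw' : z ^ Q * w ^ Q + z * (z + 1) * w = 0 := hw
    have h3 := CharTwo.add_eq_zero.1 hw'
    rw [← mul_pow, ← pow_sub_one_mul hQ] at h3
    apply mul_right_cancel₀ (mul_ne_zero h0 hw0)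
    rw [h3]
    ring
  obtain ⟨w, hw⟩ := (Finite.injective_iff_surjective.1 hL) (z + 1)
  rw [ncard_rootSet_param hQ hadd h0 h1, Set.ncard_eq_one.2 ⟨w, ?_⟩]
  ext x
  exact ⟨fun hx => hL ((show L x = z + 1 from hx).trans hw.symm), fun hx => hx ▸ hw⟩

theorem ncard_rootSet_param_of_pow [Finite K] {Q : ℕ} (hQ : Q ≠ 0)
    (hadd : ∀ x y : K, (x + y) ^ Q = x ^ Q + y ^ Q) {z u : K} (h0 : z ≠ 0) (h1 : z ≠ 1)
    (hu : u ≠ 0) (hz : z + 1 = u ^ (Q - 1)) :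
    (rootSet Q (param Q z)).ncard = {v : K | v ^ Q + v = u⁻¹}.ncard + 1 := by
  have h2 : z + 1 ≠ 0 := fun h => h1 (CharTwo.add_eq_zero.1 h)
  have huQ : u ^ Q = (z + 1) * u := by rw [hz, pow_sub_one_mul hQ]
  have hinj : Function.Injective fun v : K => u / z * v :=
    mul_right_injective₀ (div_ne_zero hu h0)
  rw [ncard_rootSet_param hQ hadd h0 h1,
    ← Set.ncard_image_of_injective {v : K | v ^ Q + v = u⁻¹} hinj]
  congr 2
  ext w
  simp only [Set.mem_image, Set.mem_ofPred_eq]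
  have hval (v : K) : z ^ Q * (u / z * v) ^ Q + z * (z + 1) * (u / z * v) =
      (z + 1) * (u * (v ^ Q + v)) := by
    rw [mul_pow, div_pow, huQ]
    have := pow_ne_zero Q h0
    field_simp
  have hiff (v : K) : z ^ Q * (u / z * v) ^ Q + z * (z + 1) * (u / z * v) = z + 1 ↔
      v ^ Q + v = u⁻¹ := by
    rw [hval, mul_eq_left₀ h2, ← mul_inv_eq_one₀ (inv_ne_zero hu), inv_inv, mul_comm]
  constructor
  · intro hw
    have hv : u / z * (z / u * w) = w := by field_simp
    exact ⟨z / u * w, (hiff _).1 (by rwa [hv]), hv⟩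
  · rintro ⟨v, hv, rfl⟩
    exact (hiff v).2 hv

theorem eq_zero_of_pow_add_self_eq {Q μ : ℕ}
    (hadd : ∀ x y : K, (x + y) ^ Q = x ^ Q + y ^ Q) (hμ : Odd μ) (hfix : ∀ x : K, x ^ Q ^ μ = x)
    {a v : K} (ha : a ^ Q = a) (hv : v ^ Q + v = a) : a = 0 := by
  have hv' : v ^ Q = v + a := by rw [← hv, add_comm (v ^ Q), CharTwo.add_cancel_left]
  have hmul (j : ℕ) : ((j : K) * a) ^ Q = j * a := by
    rw [mul_pow, ha]
    rcases CharTwo.natCast_cases (R := K) j with h | h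
    · rcases eq_or_ne Q 0 with rfl | hQ
      · have := hadd 0 0
        simp at this
      · simp [h, hQ]
    · simp [h]
  have hiter (j : ℕ) : v ^ Q ^ j = v + j * a := by
    induction j with
    | zero => simp
    | succ j ih => rw [pow_succ, pow_mul, ih, hadd, hv', hmul]; push_cast; ring
  have h := hiter μ
  rw [hfix, CharTwo.natCast_eq_ite, if_neg (Nat.not_even_iff_odd.2 hμ), one_mul] at h
  simpa using h

theorem card_ker_frobeniusAddId [Finite K] {Q q : ℕ} (hQ : 2 ≤ Q) (hq : 1 ≤ q)
    (hadd : ∀ x y : K, (x + y) ^ Q = x ^ Q + y ^ Q)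
    (hr : {x : K | x ^ (Q - 1) = 1}.ncard = q - 1) :
    Nat.card (frobeniusAddId Q hadd).ker = q := by
  have h : ((frobeniusAddId Q hadd).ker : Set K) = insert 0 {x : K | x ^ (Q - 1) = 1} := by
    ext x
    rw [SetLike.mem_coe, AddMonoidHom.mem_ker, frobeniusAddId_apply, CharTwo.add_eq_zero]
    rcases eq_or_ne x 0 with rfl | hx
    · simp; omega
    · rw [← pow_sub_one_mul (show Q ≠ 0 by omega) x, mul_eq_right₀ hx]
      simp [hx]
  rw [← SetLike.coe_sort_coe, Nat.card_coe_set_eq, h, Set.ncard_insert_of_notMem, hr]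
  · omega
  · rw [Set.mem_ofPred_eq, zero_pow (by omega)]
    exact zero_ne_one

theorem ncard_param_eq_mul [Finite K] (Q i : ℕ) :
    {z : K | (z ≠ 0 ∧ z ≠ 1) ∧ (rootSet Q (param Q z)).ncard = i}.ncard =
      i * {c : K | c ≠ 0 ∧ (rootSet Q c).ncard = i}.ncard := by
  apply Set.ncard_eq_mul_of_fiber (f := param Q)
  · rintro z ⟨⟨h0, h1⟩, h⟩
    exact ⟨param_ne_zero h0 h1, h⟩
  · rintro c ⟨hc, h⟩
    refine Eq.trans ?_ h
    congr 1
    ext z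
    rw [mem_rootSet_iff hc, Set.mem_ofPred_eq, Set.mem_ofPred_eq]
    constructor
    · rintro ⟨⟨⟨h0, h1⟩, -⟩, h2⟩
      exact ⟨h0, h1, h2⟩
    · rintro ⟨h0, h1, rfl⟩
      exact ⟨⟨⟨h0, h1⟩, h⟩, rfl⟩

theorem counts [Finite K] {Q q μ : ℕ} (hQ : 2 ≤ Q) (hq : 2 ≤ q)
    (hadd : ∀ x y : K, (x + y) ^ Q = x ^ Q + y ^ Q)
    (hr : {x : K | x ^ (Q - 1) = 1}.ncard = q - 1)
    (hμ : Odd μ) (hfix : ∀ x : K, x ^ Q ^ μ = x) :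
    (∀ c : K, c ≠ 0 → (rootSet Q c).ncard ∈ ({0, 1, 2, q + 1} : Set ℕ)) ∧
    ∃ x, x * q = Nat.card K ∧
      (q - 1) * ((q + 1) * {c : K | c ≠ 0 ∧ (rootSet Q c).ncard = q + 1}.ncard) + 1 = x ∧
      (q - 1) * {c : K | c ≠ 0 ∧ (rootSet Q c).ncard = 1}.ncard + (q - 1) + x = Nat.card K := by
  have hQ0 : Q ≠ 0 := by omega
  set I := (frobeniusAddId Q hadd).range with hI
  have hker := card_ker_frobeniusAddId hQ (by omega) hadd hr
  have hcard : Nat.card I * q = Nat.card K := by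
    rw [hI, ← AddSubgroup.index_ker, ← hker, AddSubgroup.index_mul_card]
  have hone {z u : K} (h0 : z ≠ 0) (h1 : z ≠ 1) (hu : u ≠ 0) (hz : z + 1 = u ^ (Q - 1))
      (huI : u⁻¹ ∉ I) : (rootSet Q (param Q z)).ncard = 1 := by
    rw [ncard_rootSet_param_of_pow hQ0 hadd h0 h1 hu hz, Nat.add_eq_right, Set.ncard_eq_zero,
      Set.eq_empty_iff_forall_notMem]
    exact fun v hv => huI ⟨v, hv⟩
  have hall {z u : K} (h0 : z ≠ 0) (h1 : z ≠ 1) (hu : u ≠ 0) (hz : z + 1 = u ^ (Q - 1))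
      (huI : u⁻¹ ∈ I) : (rootSet Q (param Q z)).ncard = q + 1 := by
    rw [ncard_rootSet_param_of_pow hQ0 hadd h0 h1 hu hz, ncard_fiber_frobeniusAddId hadd hker huI]
  have hpow_ne {z u : K} (h1 : z ≠ 1) (hz : z + 1 = u ^ (Q - 1)) : u ≠ 0 := by
    rintro rfl
    rw [zero_pow (by omega)] at hz
    exact h1 (CharTwo.add_eq_zero.1 hz)
  have hz_of {u : K} (hu : u ≠ 0) (hu1 : u ^ (Q - 1) ≠ 1) :
      u ^ (Q - 1) + 1 ≠ 0 ∧ u ^ (Q - 1) + 1 ≠ 1 ∧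
        u ^ (Q - 1) + 1 + 1 = u ^ (Q - 1) :=
    ⟨fun h => hu1 (CharTwo.add_eq_zero.1 h), by simp [hu], CharTwo.add_cancel_right _ _⟩
  have htriv {u : K} (hu : u ≠ 0) (huI : u⁻¹ ∈ I) : u ^ (Q - 1) ≠ 1 := by
    intro h
    obtain ⟨v, hv⟩ := huI
    refine inv_ne_zero hu (eq_zero_of_pow_add_self_eq hadd hμ hfix ?_ hv)
    rw [inv_pow, ← pow_sub_one_mul hQ0 u, h, one_mul]
  have hfib {z u : K} (h1 : z ≠ 1) (hz : z + 1 = u ^ (Q - 1)) :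
      {a : K | a ^ (Q - 1) + 1 = z}.ncard = q - 1 := by
    rw [← ncard_pow_eq hr (hpow_ne h1 hz), ← hz]
    congr 1
    ext a
    exact CharTwo.eq_add_iff_add_eq.symm
  have hcases {z : K} (h0 : z ≠ 0) (h1 : z ≠ 1) :
      (rootSet Q (param Q z)).ncard = 2 ∨ ∃ u : K, z + 1 = u ^ (Q - 1) := by
    by_cases hz : ∃ u : K, z + 1 = u ^ (Q - 1)
    · exact .inr hz
    · exact .inl (ncard_rootSet_param_of_not_pow hQ0 hadd h0 h1 hz)
  have hA : {u : K | u ≠ 0 ∧ u⁻¹ ∈ I}.ncard =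
      (q - 1) * ((q + 1) * {c : K | c ≠ 0 ∧ (rootSet Q c).ncard = q + 1}.ncard) := by
    rw [← ncard_param_eq_mul]
    apply Set.ncard_eq_mul_of_fiber (f := fun u => u ^ (Q - 1) + 1)
    · rintro u ⟨hu, huI⟩
      obtain ⟨h0, h1, h2⟩ := hz_of hu (htriv hu huI)
      exact ⟨⟨h0, h1⟩, hall h0 h1 hu h2 huI⟩
    · rintro z ⟨⟨h0, h1⟩, h⟩
      obtain ⟨u, hz⟩ := (hcases h0 h1).resolve_left (by omega)
      rw [← hfib h1 hz]
      congr 1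
      ext a
      refine ⟨And.right, fun ha => ?_⟩
      have hz' : z + 1 = a ^ (Q - 1) := CharTwo.eq_add_iff_add_eq.1 (Eq.symm ha)
      have ha0 := hpow_ne h1 hz'
      refine ⟨⟨ha0, ?_⟩, ha⟩
      by_contra hn
      have := hone h0 h1 ha0 hz' hn
      omega
  have hB : {u : K | (u ≠ 0 ∧ u⁻¹ ∉ I) ∧ u ^ (Q - 1) ≠ 1}.ncard =
      (q - 1) * {c : K | c ≠ 0 ∧ (rootSet Q c).ncard = 1}.ncard := by
    rw [← one_mul {c : K | c ≠ 0 ∧ (rootSet Q c).ncard = 1}.ncard, ← ncard_param_eq_mul]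
    apply Set.ncard_eq_mul_of_fiber (f := fun u => u ^ (Q - 1) + 1)
    · rintro u ⟨⟨hu, huI⟩, hu1⟩
      obtain ⟨h0, h1, h2⟩ := hz_of hu hu1
      exact ⟨⟨h0, h1⟩, hone h0 h1 hu h2 huI⟩
    · rintro z ⟨⟨h0, h1⟩, h⟩
      obtain ⟨u, hz⟩ := (hcases h0 h1).resolve_left (by omega)
      rw [← hfib h1 hz]
      congr 1
      ext a
      refine ⟨And.right, fun ha => ?_⟩
      have hz' : z + 1 = a ^ (Q - 1) := CharTwo.eq_add_iff_add_eq.1 (Eq.symm ha)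
      have ha0 := hpow_ne h1 hz'
      refine ⟨⟨⟨ha0, ?_⟩, ?_⟩, ha⟩
      · intro hn
        have := hall h0 h1 ha0 hz' hn
        omega
      · rw [← hz']
        simpa using h0
  have hC : {u : K | u ≠ 0 ∧ u⁻¹ ∈ I}.ncard + 1 = Nat.card I := by
    rw [← SetLike.coe_sort_coe, Nat.card_coe_set_eq,
      ← Set.ncard_sdiff_singleton_add_one (a := (0 : K)) (s := (I : Set K)) I.zero_mem,
      ← Set.ncard_image_of_injective _ (inv_injective (G := K))]
    congr 2
    ext u
    simp [and_comm]
  have hD : {u : K | (u ≠ 0 ∧ u⁻¹ ∉ I) ∧ ¬ u ^ (Q - 1) ≠ 1}.ncard = q - 1 := by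
    rw [← hr]
    congr 1
    ext u
    simp only [Set.mem_ofPred_eq, not_not]
    refine ⟨And.right, fun h => ⟨?_, h⟩⟩
    have hu : u ≠ 0 := by
      rintro rfl
      rw [zero_pow (by omega)] at h
      exact zero_ne_one h
    exact ⟨hu, fun huI => htriv hu huI h⟩
  have hE := Set.ncard_ne_zero_add_one (K := K)
  have hsplit := Set.ncard_sep_add_ncard_sep_not {u : K | u ≠ 0} (fun u => u⁻¹ ∈ I)
  have hsplit' := Set.ncard_sep_add_ncard_sep_not {u : K | u ≠ 0 ∧ u⁻¹ ∉ I}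
    (fun u => u ^ (Q - 1) ≠ 1)
  simp only [Set.mem_ofPred_eq] at hsplit hsplit'
  refine ⟨fun c hc => ?_, Nat.card I, hcard, by omega, by omega⟩
  rcases (rootSet Q c).eq_empty_or_nonempty with h | ⟨z, hz⟩
  · simp [h]
  · obtain ⟨h0, h1, rfl⟩ := (mem_rootSet_iff hc).1 hz
    rcases hcases h0 h1 with h | ⟨u, hu⟩
    · simp [h]
    · by_cases huI : u⁻¹ ∈ I
      · simp [hall h0 h1 (hpow_ne h1 hu) hu huI]
      · simp [hone h0 h1 (hpow_ne h1 hu) hu huI]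

theorem sum_counts [Finite K] {Q q : ℕ} (hq : 2 ≤ q)
    (h : ∀ c : K, c ≠ 0 → (rootSet Q c).ncard ∈ ({0, 1, 2, q + 1} : Set ℕ)) :
    {c : K | c ≠ 0 ∧ (rootSet Q c).ncard = 0}.ncard +
      ({c : K | c ≠ 0 ∧ (rootSet Q c).ncard = 1}.ncard +
      ({c : K | c ≠ 0 ∧ (rootSet Q c).ncard = 2}.ncard +
      {c : K | c ≠ 0 ∧ (rootSet Q c).ncard = q + 1}.ncard)) + 1 = Nat.card K ∧
    {c : K | c ≠ 0 ∧ (rootSet Q c).ncard = 1}.ncard +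
      (2 * {c : K | c ≠ 0 ∧ (rootSet Q c).ncard = 2}.ncard +
      (q + 1) * {c : K | c ≠ 0 ∧ (rootSet Q c).ncard = q + 1}.ncard) + 2 = Nat.card K := by
  have hsum (g : ℕ → ℕ) : ∑ i ∈ {0, 1, 2, q + 1}, g i = g 0 + (g 1 + (g 2 + g (q + 1))) := by
    rw [Finset.sum_insert (by simp), Finset.sum_insert (by simp; omega),
      Finset.sum_insert (by simp; omega), Finset.sum_singleton]
  have hpar := Set.ncard_eq_sum_ncard_fiber (S := {c : K | c ≠ 0}) (T := {0, 1, 2, q + 1})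
    (f := fun c => (rootSet Q c).ncard) fun c hc => by simpa using h c hc
  have hroot := Set.ncard_eq_sum_ncard_fiber (S := {z : K | z ≠ 0 ∧ z ≠ 1})
    (T := {0, 1, 2, q + 1}) (f := fun z => (rootSet Q (param Q z)).ncard)
    fun z hz => by simpa using h _ (param_ne_zero hz.1 hz.2)
  have htotal : {z : K | z ≠ 0 ∧ z ≠ 1}.ncard + 1 = {z : K | z ≠ 0}.ncard := by
    rw [← Set.ncard_sdiff_singleton_add_one (a := (1 : K)) (s := {z : K | z ≠ 0}) one_ne_zero]
    congr 2
  have hE := Set.ncard_ne_zero_add_one (K := K)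
  simp only [hsum, Set.mem_ofPred_eq] at hpar hroot
  simp only [ncard_param_eq_mul, zero_mul, zero_add, one_mul] at hroot
  omega

end CharTwo

end Bluher

/-- Bluher's count. Let `n, t` be positive integers, `k = gcd(t, n)`,
`q = 2^k`, and suppose `μ = n/k` is odd.  Let `K` be the field with `2^n` elements.
For `i ∈ {0, 1, 2, q+1}` let `N_i` be the number of `c ∈ K^*` such that
`h_c(z) = z^{2^t+1} + c·z + c` has exactly `i` roots in `K`.  Then every `c ∈ K^*` gives
`0`, `1`, `2` or `q+1` roots, and `2(q+1)·N_0 = q^{μ+1} + q`, `N_1 = q^{μ−1} − 1`,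
`2(q−1)·N_2 = (q−2)(q^μ − 1)`, `(q²−1)·N_{q+1} = q^{μ−1} − 1`. -/
theorem bluher_root_counts
    (n t k q μ : ℕ) (hn : 0 < n) (ht : 0 < t)
    (hk : k = Nat.gcd t n) (hq : q = 2 ^ k) (hμ : μ = n / k) (hμodd : Odd μ)
    (K : Type) [Field K] [Fintype K] (hK : Fintype.card K = 2 ^ n) :
    (∀ c : K, c ≠ 0 →
        Nat.card {z : K | z ^ (2 ^ t + 1) + c * z + c = 0}
          ∈ ({0, 1, 2, q + 1} : Set ℕ)) ∧
    2 * (q + 1) *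
        Nat.card {c : K | c ≠ 0 ∧
          Nat.card {z : K | z ^ (2 ^ t + 1) + c * z + c = 0} = 0}
      = q ^ (μ + 1) + q ∧
    Nat.card {c : K | c ≠ 0 ∧
          Nat.card {z : K | z ^ (2 ^ t + 1) + c * z + c = 0} = 1}
      = q ^ (μ - 1) - 1 ∧
    2 * (q - 1) *
        Nat.card {c : K | c ≠ 0 ∧
          Nat.card {z : K | z ^ (2 ^ t + 1) + c * z + c = 0} = 2}
      = (q - 2) * (q ^ μ - 1) ∧
    (q ^ 2 - 1) *
        Nat.card {c : K | c ≠ 0 ∧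
          Nat.card {z : K | z ^ (2 ^ t + 1) + c * z + c = 0} = q + 1}
      = q ^ (μ - 1) - 1 := by
  have hk0 : 0 < k := hk ▸ Nat.gcd_pos_of_pos_left n ht
  have hq2 : 2 ≤ q := hq ▸ Nat.le_self_pow hk0.ne' 2
  have hQ2 : 2 ≤ 2 ^ t := Nat.le_self_pow ht.ne' 2
  have : CharP K 2 := charP_of_card_eq_prime_pow hK
  have hNK : Nat.card K = 2 ^ n := Nat.card_eq_fintype_card.trans hK
  have hkμ : k * μ = n := hμ ▸ Nat.mul_div_cancel' (hk ▸ Nat.gcd_dvd_right t n)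
  have hadd (x y : K) : (x + y) ^ 2 ^ t = x ^ 2 ^ t + y ^ 2 ^ t := add_pow_expChar_pow ..
  have hr : {x : K | x ^ (2 ^ t - 1) = 1}.ncard = q - 1 := by
    rw [FiniteField.ncard_pow_eq_one _ (by omega), hNK, Nat.pow_sub_one_gcd_pow_sub_one,
      Nat.gcd_comm, ← hk, hq]
  have hfix (x : K) : x ^ (2 ^ t) ^ μ = x := by
    obtain ⟨d, hd⟩ : k ∣ t := hk ▸ Nat.gcd_dvd_left t n
    rw [← pow_mul, show t * μ = n * d by rw [← hkμ, hd]; ring, pow_mul, ← hK,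
      FiniteField.pow_card_pow]
  obtain ⟨hmem, x, hx, hall, hone⟩ := Bluher.counts hQ2 hq2 hadd hr hμodd hfix
  obtain ⟨hpar, hroot⟩ := Bluher.sum_counts hq2 hmem
  refine ⟨hmem, ?_⟩
  change _ * {c : K | c ≠ 0 ∧ (Bluher.rootSet (2 ^ t) c).ncard = 0}.ncard = _ ∧
    {c : K | c ≠ 0 ∧ (Bluher.rootSet (2 ^ t) c).ncard = 1}.ncard = _ ∧
    _ * {c : K | c ≠ 0 ∧ (Bluher.rootSet (2 ^ t) c).ncard = 2}.ncard = _ ∧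
    _ * {c : K | c ≠ 0 ∧ (Bluher.rootSet (2 ^ t) c).ncard = q + 1}.ncard = _
  have hcard : Nat.card K = q ^ μ := by rw [hNK, hq, ← pow_mul, hkμ]
  generalize {c : K | c ≠ 0 ∧ (Bluher.rootSet (2 ^ t) c).ncard = 0}.ncard = N₀ at *
  generalize {c : K | c ≠ 0 ∧ (Bluher.rootSet (2 ^ t) c).ncard = 1}.ncard = N₁ at *
  generalize {c : K | c ≠ 0 ∧ (Bluher.rootSet (2 ^ t) c).ncard = 2}.ncard = N₂ at *
  generalize {c : K | c ≠ 0 ∧ (Bluher.rootSet (2 ^ t) c).ncard = q + 1}.ncard = N₃ at *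
  obtain ⟨m, rfl⟩ : ∃ m, μ = m + 1 := ⟨μ - 1, by have := hμodd.pos; omega⟩
  obtain rfl : x = q ^ m := Nat.eq_of_mul_eq_mul_right (by omega : 0 < q) (by
    rw [hx, hcard, pow_succ])
  rw [hcard] at hpar hroot hone
  simp only [Nat.add_sub_cancel]
  have hxpos : 1 ≤ q ^ m := Nat.one_le_pow _ _ (by omega)
  have hxpos' : 1 ≤ q ^ (m + 1) := Nat.one_le_pow _ _ (by omega)
  have hsq : 1 ≤ q ^ 2 := Nat.one_le_pow _ _ (by omega)
  have hq1 : 1 ≤ q := by omega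
  have hq0 : (q : ℤ) - 1 ≠ 0 := by omega
  zify [hxpos, hxpos', hsq, hq2, hq1] at hpar hroot hone hall ⊢
  have hN₁ : (N₁ : ℤ) = q ^ m - 1 := by
    apply mul_left_cancel₀ hq0
    linear_combination hone
  refine ⟨?_, hN₁, ?_, ?_⟩
  · linear_combination 2 * (q + 1) * hpar - (q + 1) * hroot - (q + 1) * hN₁ + hall
  · linear_combination (q - 1) * hroot - (q - 1) * hN₁ - hall
  · linear_combination hall
end

section
/- For every a ∈ F_{2^n}^*: N(f_a, F) = 1 if and only if the number of roots of g_a lying in the subfield F_{2^n} is 0 or 2; and N(f_a, F) = 2^{2k} if and only if the number of roots of g_a lying in F_{2^n} is 1 or 2^k + 1. Here f_a(x) = x^{2^{2t}} + a^{2^l}·x^{2^t} + x and g_a(y) = y^{2^t + 1} + a^{2^l}·y + 1. -/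
/-- In the field with `2 ^ m` elements, `x ↦ x ^ 2 ^ j` has `2 ^ gcd j m` fixed points. -/
theorem card_fixed_pow_two_pow {F : Type*} [Field F] [Finite F] {m : ℕ}
    (hF : Nat.card F = 2 ^ m) (j : ℕ) :
    Nat.card {x : F | x ^ 2 ^ j = x} = 2 ^ Nat.gcd j m := by
  have hker : Nat.card (powMonoidHom (α := Fˣ) (2 ^ j - 1)).ker = 2 ^ Nat.gcd j m - 1 := by
    rw [IsCyclic.card_powMonoidHom_ker, Nat.card_units, hF, Nat.gcd_comm,
      Nat.pow_sub_one_gcd_pow_sub_one]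
  have hpos : 0 < 2 ^ j := by positivity
  have hset : {x : F | x ^ 2 ^ j = x} =
      insert 0 ((fun u : Fˣ => (u : F)) '' (powMonoidHom (α := Fˣ) (2 ^ j - 1)).ker) := by
    ext x
    simp only [Set.mem_ofPred_eq, Set.mem_insert_iff, Set.mem_image, SetLike.mem_coe,
      MonoidHom.mem_ker, powMonoidHom_apply]
    constructor
    · intro hx
      by_cases h0 : x = 0
      · exact Or.inl h0
      · refine Or.inr ⟨Units.mk0 x h0, Units.ext ?_, rfl⟩
        apply mul_right_cancel₀ h0
        simp only [Units.val_pow_eq_pow_val, Units.val_mk0, Units.val_one, one_mul]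
        rw [← pow_succ, Nat.sub_add_cancel hpos, hx]
    · rintro (rfl | ⟨u, hu, rfl⟩)
      · exact zero_pow hpos.ne'
      · rw [← Nat.sub_add_cancel hpos, pow_succ, ← Units.val_pow_eq_pow_val, hu, Units.val_one,
          one_mul]
  rw [hset, Nat.card_coe_set_eq, Set.ncard_insert_of_notMem (by simp) (Set.toFinite _),
    Set.ncard_image_of_injective _ Units.val_injective, ← Nat.card_coe_set_eq]
  have h := Nat.one_le_two_pow (n := Nat.gcd j m)
  change Nat.card (powMonoidHom (α := Fˣ) (2 ^ j - 1)).ker + 1 = _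
  omega

/-- If `τ` is an involution of the finite field `F` of characteristic two with `(Nat.card K) ^ 2 =
Nat.card F`, where `K` is the fixed set of `τ`, then every element of `K` has the form
`τ v + v`. -/
theorem exists_add_eq_of_involution {F : Type*} [Field F] [Finite F] [CharP F 2] (τ : F →+* F)
    (hτ : ∀ x, τ (τ x) = x) (hcard : Nat.card {x : F | τ x = x} ^ 2 = Nat.card F)
    {w : F} (hw : τ w = w) : ∃ v, τ v + v = w := by
  let D : F →+ F := τ.toAddMonoidHom + AddMonoidHom.id F
  have hD : ∀ x, D x = τ x + x := fun _ => rfl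
  have hker : (D.ker : Set F) = {x : F | τ x = x} := by
    ext x
    simp [AddMonoidHom.mem_ker, hD, CharTwo.add_eq_zero]
  have hle : (D.range : Set F) ⊆ {x : F | τ x = x} := by
    rintro _ ⟨x, rfl⟩
    simp [hD, hτ, add_comm]
  have hmul := D.ker.card_mul_index
  rw [AddSubgroup.index_ker] at hmul
  have hk : Nat.card D.ker = Nat.card {x : F | τ x = x} := by rw [← hker]; rfl
  have hpos : 0 < Nat.card D.ker := Nat.card_pos
  have hr : Nat.card D.range = Nat.card {x : F | τ x = x} := by
    rw [← hcard, ← hk, sq] at hmul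
    rw [← hk]
    exact Nat.eq_of_mul_eq_mul_left hpos hmul
  have heq : (D.range : Set F) = {x : F | τ x = x} := by
    apply Set.eq_of_subset_of_ncard_le hle _ (Set.toFinite _)
    rw [← Nat.card_coe_set_eq, ← Nat.card_coe_set_eq]
    exact hr.ge
  have : w ∈ (D.range : Set F) := heq ▸ hw
  exact this

/-- In characteristic two, every element `σ^[r] v + v` is of the form `σ u + u`. -/
theorem exists_add_eq_iterate_add {F : Type*} [Field F] [CharP F 2] (σ : F →+* F)
    (r : ℕ) (v : F) : ∃ u, σ u + u = σ^[r] v + v := by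
  induction r with
  | zero => exact ⟨0, by simp [CharTwo.add_self_eq_zero]⟩
  | succ r ih =>
    obtain ⟨u, hu⟩ := ih
    refine ⟨u + σ^[r] v, ?_⟩
    rw [map_add, Function.iterate_succ_apply']
    linear_combination hu + CharTwo.add_self_eq_zero (σ^[r] v)

/-- The solutions of `σ (σ z) + c * σ z + z = 0` are the products of a nonzero solution `x` with
the combinations of `1` and `u`, where `σ u + u = (x * σ x)⁻¹`. -/
theorem card_linear_recurrence_eq_sq {F : Type*} [Field F] [CharP F 2] (σ : F →+* F)
    {x c u : F} (hx0 : x ≠ 0) (hx : σ (σ x) + c * σ x + x = 0) (hu : σ u + u = (x * σ x)⁻¹) :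
    Nat.card {z : F | σ (σ z) + c * σ z + z = 0} = Nat.card {e : F | σ e = e} ^ 2 := by
  have h2 : (2 : F) = 0 := CharTwo.two_eq_zero
  have hs0 : σ x ≠ 0 := by simpa using hx0
  have hu' : x * σ x * (σ u + u) = 1 := by
    rw [hu]; exact mul_inv_cancel₀ (mul_ne_zero hx0 hs0)
  have hu'' : σ x * σ (σ x) * (σ (σ u) + σ u) = 1 := by simpa using congrArg σ hu'
  rw [sq, ← Nat.card_prod]
  symm
  refine Nat.card_congr (Equiv.ofBijective (fun p => ⟨x * (p.1.1 * u + p.2.1), ?_⟩) ⟨?_, ?_⟩)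
  · obtain ⟨⟨e, he⟩, ⟨d, hd⟩⟩ := p
    simp only [Set.mem_ofPred_eq] at he hd ⊢
    simp only [map_mul, map_add, he, hd]
    apply mul_left_cancel₀ hs0
    linear_combination (e * σ x * σ u + d * σ x) * hx + e * hu'' + e * hu'
      + (e - e * σ x * x * σ u - e * σ x * σ (σ x) * σ u) * h2
  · rintro ⟨⟨e, he⟩, ⟨d, hd⟩⟩ ⟨⟨e', he'⟩, ⟨d', hd'⟩⟩ h
    simp only [Set.mem_ofPred_eq] at he hd he' hd'
    simp only [Subtype.mk.injEq, mul_eq_mul_left_iff, hx0, or_false] at h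
    have h' := congrArg σ h
    simp only [map_add, map_mul, he, hd, he', hd'] at h'
    have hee : e = e' := by
      linear_combination (-e + e') * hu' + x * σ x * (h + h') - x * σ x * (d - d') * h2
    subst hee
    simpa using h
  · rintro ⟨z, hz⟩
    simp only [Set.mem_ofPred_eq] at hz
    set q := z / x with hq
    have hzq : z = x * q := by rw [hq]; field_simp
    have hW : σ x * σ (σ x) * (σ (σ q) + σ q) = x * σ x * (σ q + q) := by
      rw [hzq] at hz
      simp only [map_mul] at hz
      linear_combination σ x * hz - σ x * σ q * hx
        + (σ x * σ (σ x) * σ q - x * σ x * q) * h2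
    refine ⟨⟨⟨x * σ x * (σ q + q), ?_⟩, ⟨q + x * σ x * (σ q + q) * u, ?_⟩⟩, ?_⟩
    · simpa only [Set.mem_ofPred_eq, map_mul, map_add] using hW
    · simp only [Set.mem_ofPred_eq, map_mul, map_add, hW]
      linear_combination (σ q + q) * hu' + (σ q - x * σ x * (σ q + q) * u) * h2
    · apply Subtype.ext
      simp only [hzq]
      linear_combination (x * x * σ x * (σ q + q) * u) * h2

/-- Substituting `y = y₀ + h⁻¹` linearizes the equation `y * σ y + c * y + 1 = 0`. -/
theorem riccati_add_inv_iff {F : Type*} [Field F] [CharP F 2] (σ : F →+* F) {c y₀ h : F}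
    (hy : y₀ * σ y₀ + c * y₀ + 1 = 0) (hh : h ≠ 0) :
    (y₀ + h⁻¹) * σ (y₀ + h⁻¹) + c * (y₀ + h⁻¹) + 1 = 0 ↔ σ h + y₀ ^ 2 * h = y₀ := by
  have h2 : (2 : F) = 0 := CharTwo.two_eq_zero
  have hs : σ h ≠ 0 := by simpa using hh
  have hy0 : y₀ ≠ 0 := by rintro rfl; simp at hy
  rw [map_add, map_inv₀]
  have key : ((y₀ + h⁻¹) * (σ y₀ + (σ h)⁻¹) + c * (y₀ + h⁻¹) + 1) * (h * σ h * y₀)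
      = σ h + y₀ ^ 2 * h - y₀ := by
    field_simp
    linear_combination (y₀ * h * σ h + σ h) * hy + (y₀ - σ h) * h2
  rw [← sub_eq_zero (a := σ h + _), ← key, mul_eq_zero, or_iff_left]
  exact mul_ne_zero (mul_ne_zero hh hs) hy0

theorem card_riccati_eq_succ {F : Type*} [Field F] [Finite F] [CharP F 2] (σ τ : F →+* F)
    {c y₀ : F} (hy : y₀ * σ y₀ + c * y₀ + 1 = 0) (hτy : τ y₀ = y₀) :
    Nat.card {y : F | y * σ y + c * y + 1 = 0 ∧ τ y = y} =
      Nat.card {h : F | σ h + y₀ ^ 2 * h = y₀ ∧ τ h = h} + 1 := by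
  have hy0 : y₀ ≠ 0 := by rintro rfl; simp at hy
  have hne : ∀ h : F, σ h + y₀ ^ 2 * h = y₀ → h ≠ 0 := by
    rintro h hh rfl
    simp [hy0.symm] at hh
  have hset : {y : F | y * σ y + c * y + 1 = 0 ∧ τ y = y} =
      insert y₀ ((fun h => y₀ + h⁻¹) '' {h : F | σ h + y₀ ^ 2 * h = y₀ ∧ τ h = h}) := by
    ext y
    simp only [Set.mem_ofPred_eq, Set.mem_insert_iff, Set.mem_image]
    constructor
    · rintro ⟨h1, h2⟩
      by_cases hyy : y = y₀
      · exact Or.inl hyy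
      · right
        have hd : (y + y₀)⁻¹ ≠ 0 := inv_ne_zero fun h => hyy (CharTwo.add_eq_zero.mp h)
        have hback : y₀ + ((y + y₀)⁻¹)⁻¹ = y := by
          rw [inv_inv, add_comm y, CharTwo.add_cancel_left]
        refine ⟨(y + y₀)⁻¹, ⟨(riccati_add_inv_iff σ hy hd).mp (by rwa [hback]), ?_⟩, hback⟩
        rw [map_inv₀, map_add, h2, hτy]
    · rintro (rfl | ⟨h, ⟨h1, h2⟩, rfl⟩)
      · exact ⟨hy, hτy⟩
      · exact ⟨(riccati_add_inv_iff σ hy (hne h h1)).mpr h1, by rw [map_add, map_inv₀, h2, hτy]⟩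
  rw [hset, Nat.card_coe_set_eq, Set.ncard_insert_of_notMem _ (Set.toFinite _),
    Set.ncard_image_of_injective, ← Nat.card_coe_set_eq]
  · intro a b hab
    simpa using hab
  · rintro ⟨h, ⟨h1, -⟩, hh⟩
    exact hne h h1 (by simpa using hh)

/-- If the homogeneous recurrence has only the trivial solution, the Riccati equation has no
or two `τ`-fixed solutions. -/
theorem card_riccati_of_trivial {F : Type*} [Field F] [Finite F] [CharP F 2] (σ τ : F →+* F)
    (hστ : ∀ x, σ (τ x) = τ (σ x)) {c : F}
    (htriv : ∀ x : F, σ (σ x) + c * σ x + x = 0 → x = 0) :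
    Nat.card {y : F | y * σ y + c * y + 1 = 0 ∧ τ y = y} = 0 ∨
      Nat.card {y : F | y * σ y + c * y + 1 = 0 ∧ τ y = y} = 2 := by
  rcases Set.eq_empty_or_nonempty {y : F | y * σ y + c * y + 1 = 0 ∧ τ y = y} with h | ⟨y₀, hy, hτy⟩
  · left
    rw [h]
    simp
  right
  have hy0 : y₀ ≠ 0 := by rintro rfl; simp at hy
  rw [card_riccati_eq_succ σ τ hy hτy]
  let L : {x : F // τ x = x} → {x : F // τ x = x} :=
    fun h => ⟨σ h.1 + y₀ ^ 2 * h.1, by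
      rw [map_add, map_mul, map_pow, hτy, ← hστ, h.2]⟩
  have hinj : Function.Injective L := by
    rintro ⟨a, ha⟩ ⟨b, hb⟩ hab
    have hab' : σ a + y₀ ^ 2 * a = σ b + y₀ ^ 2 * b := congrArg Subtype.val hab
    obtain ⟨x, hx⟩ := (Finite.injective_iff_surjective.mp (frobenius F 2).injective) (a + b)
    simp only [frobenius_def] at hx
    have h1 : (σ x + y₀ * x) ^ 2 = 0 := by
      rw [CharTwo.add_sq, mul_pow, ← map_pow, hx, map_add]
      rw [← CharTwo.add_eq_zero] at hab'
      linear_combination hab'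
    have h2 : σ x = y₀ * x := CharTwo.add_eq_zero.mp (pow_eq_zero_iff two_ne_zero |>.mp h1)
    have hx0 : x = 0 := htriv x (by
      rw [h2, map_mul, h2]
      linear_combination x * hy)
    apply Subtype.ext
    apply CharTwo.add_eq_zero.mp
    rw [← hx, hx0]
    simp
  obtain ⟨⟨h, hh⟩, hL⟩ := (Finite.injective_iff_surjective.mp hinj) ⟨y₀, hτy⟩
  have hset : {h : F | σ h + y₀ ^ 2 * h = y₀ ∧ τ h = h} = {h} := by
    ext g
    simp only [Set.mem_ofPred_eq, Set.mem_singleton_iff]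
    constructor
    · rintro ⟨h1, h2⟩
      have : L ⟨g, h2⟩ = L ⟨h, hh⟩ := by rw [hL]; exact Subtype.ext h1
      exact congrArg Subtype.val (hinj this)
    · rintro rfl
      exact ⟨congrArg Subtype.val hL, hh⟩
  rw [hset]
  simp

/-- If the homogeneous recurrence has a nonzero `τ`-fixed solution, the Riccati equation has
one `τ`-fixed solution or one more than the number of fixed points of `σ`. -/
theorem card_riccati_of_nontrivial {F : Type*} [Field F] [Finite F] [CharP F 2] (σ τ : F →+* F)
    (hfix : ∀ e, σ e = e → τ e = e) {c x : F} (hx0 : x ≠ 0)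
    (hx : σ (σ x) + c * σ x + x = 0) (hτσ : τ (σ x) = σ x) (hτx : τ x = x) :
    Nat.card {y : F | y * σ y + c * y + 1 = 0 ∧ τ y = y} = 1 ∨
      Nat.card {y : F | y * σ y + c * y + 1 = 0 ∧ τ y = y} = Nat.card {e : F | σ e = e} + 1 := by
  have hs0 : σ x ≠ 0 := by simpa using hx0
  have hy : (σ x / x) * σ (σ x / x) + c * (σ x / x) + 1 = 0 := by
    rw [map_div₀]
    field_simp
    linear_combination hx
  have hτy : τ (σ x / x) = σ x / x := by rw [map_div₀, hτσ, hτx]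
  rw [card_riccati_eq_succ σ τ hy hτy]
  rcases Set.eq_empty_or_nonempty
    {h : F | σ h + (σ x / x) ^ 2 * h = σ x / x ∧ τ h = h} with h | ⟨h₀, hh, hτh⟩
  · left
    rw [h]
    simp
  right
  have hset : {h : F | σ h + (σ x / x) ^ 2 * h = σ x / x ∧ τ h = h} =
      (fun e => h₀ + x ^ 2 * e) '' {e : F | σ e = e} := by
    ext g
    simp only [Set.mem_ofPred_eq, Set.mem_image]
    constructor
    · rintro ⟨h1, h2⟩
      refine ⟨(g + h₀) / x ^ 2, ?_, ?_⟩
      · rw [map_div₀, map_add, map_pow]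
        have h3 : σ g + σ h₀ = (σ x / x) ^ 2 * (g + h₀) := by
          linear_combination h1 - hh + (σ h₀ - (σ x / x) ^ 2 * g) *
            (CharTwo.two_eq_zero : (2 : F) = 0)
        rw [h3]
        field_simp
      · rw [mul_div_cancel₀ _ (pow_ne_zero 2 hx0), add_comm g, CharTwo.add_cancel_left]
    · rintro ⟨e, he, rfl⟩
      refine ⟨?_, by rw [map_add, map_mul, map_pow, hfix e he, hτh, hτx]⟩
      rw [map_add, map_mul, map_pow, he]
      have h4 : (σ x / x) ^ 2 * (x ^ 2 * e) = σ x ^ 2 * e := by field_simp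
      linear_combination hh + h4 + σ x ^ 2 * e * (CharTwo.two_eq_zero : (2 : F) = 0)
  rw [hset, Nat.card_coe_set_eq, Set.ncard_image_of_injective, ← Nat.card_coe_set_eq]
  intro a b hab
  simpa [hx0] using hab

/-- With the standing notation (`n = kr`, `m = 2n`, `l = ks`,
`t = n + l`, …), for every `a ∈ F_{2^n}^*`: `N(f_a, F) = 1` iff the number of roots of
`g_a` lying in the subfield `F_{2^n}` is `0` or `2`, and `N(f_a, F) = 2^{2k}` iff that
number is `1` or `2^k + 1`.  Here `f_a(x) = x^{2^{2t}} + a^{2^l}·x^{2^t} + x` and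
`g_a(y) = y^{2^t+1} + a^{2^l}·y + 1`. -/
theorem card_roots_f_iff_card_roots_g_in_subfield
    (k r s n m l t : ℕ) (hk : 1 ≤ k) (hr : 3 ≤ r) (hro : Odd r)
    (hn : n = k * r) (hm : m = 2 * n) (hl : l = k * s)
    (hse : Even s) (hs0 : 0 < s) (hsr : s < r) (hrs : Nat.gcd r s = 1)
    (ht : t = n + l)
    (F : Type) [Field F] [Fintype F] (hF : Fintype.card F = 2 ^ m)
    (a : F) (ha0 : a ≠ 0) (han : a ^ 2 ^ n = a) :
    (Nat.card {x : F | x ^ 2 ^ (2 * t) + a ^ 2 ^ l * x ^ 2 ^ t + x = 0} = 1 ↔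
      (Nat.card {y : F | (y ^ (2 ^ t + 1) + a ^ 2 ^ l * y + 1 = 0) ∧ y ^ 2 ^ n = y} = 0 ∨
       Nat.card {y : F | (y ^ (2 ^ t + 1) + a ^ 2 ^ l * y + 1 = 0) ∧ y ^ 2 ^ n = y} = 2)) ∧
    (Nat.card {x : F | x ^ 2 ^ (2 * t) + a ^ 2 ^ l * x ^ 2 ^ t + x = 0} = 2 ^ (2 * k) ↔
      (Nat.card {y : F | (y ^ (2 ^ t + 1) + a ^ 2 ^ l * y + 1 = 0) ∧ y ^ 2 ^ n = y} = 1 ∨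
       Nat.card {y : F | (y ^ (2 ^ t + 1) + a ^ 2 ^ l * y + 1 = 0) ∧ y ^ 2 ^ n = y}
         = 2 ^ k + 1)) := by
  have hcardF : Nat.card F = 2 ^ m := by rw [Nat.card_eq_fintype_card, hF]
  have : CharP F 2 := by
    have : Fact (Nat.Prime 2) := ⟨Nat.prime_two⟩
    exact charP_of_card_eq_prime_pow hF
  set c : F := a ^ 2 ^ l with hc
  let σ : F →+* F := iterateFrobenius F 2 t
  let τ : F →+* F := iterateFrobenius F 2 n
  have hσ : ∀ x, σ x = x ^ 2 ^ t := fun _ => rfl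
  have hτ : ∀ x, τ x = x ^ 2 ^ n := fun _ => rfl
  have hσσ : ∀ x, σ (σ x) = x ^ 2 ^ (2 * t) := fun x => by
    rw [hσ, hσ, ← pow_mul, ← pow_add, two_mul]
  have hστ : ∀ x, σ (τ x) = τ (σ x) := fun x => by
    rw [hσ, hσ, hτ, hτ, ← pow_mul, ← pow_mul, mul_comm]
  have hττ : ∀ x, τ (τ x) = x := fun x => by
    rw [hτ, hτ, ← pow_mul, ← pow_add, ← two_mul, ← hm, ← hF, FiniteField.pow_card]
  have hrs_odd : Odd (r + s) := hro.add_even hse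
  have htr : t * r = n * (r + s) := by rw [ht, hl, hn]; ring
  have hiter : ∀ x, σ^[r] x = τ x := fun x => by
    have h1 : σ^[r] x = τ^[r + s] x := by
      have hσ' : (σ : F → F) = (frobenius F 2)^[t] := coe_iterateFrobenius F 2 t
      have hτ' : (τ : F → F) = (frobenius F 2)^[n] := coe_iterateFrobenius F 2 n
      rw [hσ', hτ', ← Function.iterate_mul, ← Function.iterate_mul, htr]
    rw [h1]
    exact congrFun (Function.Involutive.iterate_odd hττ hrs_odd) x
  have hfix : ∀ e, σ e = e → τ e = e := fun e he => by
    rw [← hiter]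
    exact Function.iterate_fixed he r
  have hτc : τ c = c := by
    rw [hτ, hc, ← pow_mul, mul_comm, pow_mul, han]
  have hcardK : Nat.card {x : F | τ x = x} ^ 2 = Nat.card F := by
    rw [hcardF]
    simp only [hτ]
    rw [card_fixed_pow_two_pow hcardF, hm, Nat.gcd_mul_left_right, ← pow_mul, mul_comm]
  have hgcd : Nat.gcd t m = k := by
    have h1 : t = k * (r + s) := by rw [ht, hl, hn]; ring
    have h2 : m = k * (2 * r) := by rw [hm, hn]; ring
    rw [h1, h2, Nat.gcd_mul_left]
    have h3 : Nat.Coprime (r + s) (2 * r) := by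
      apply Nat.Coprime.mul_right
      · exact Nat.coprime_two_right.mpr hrs_odd
      · rw [Nat.coprime_comm]
        simpa using hrs
    rw [h3.gcd_eq_one, mul_one]
  have hcard0 : Nat.card {e : F | σ e = e} = 2 ^ k := by
    simp only [hσ]
    rw [card_fixed_pow_two_pow hcardF, hgcd]
  have hfeq : {x : F | x ^ 2 ^ (2 * t) + c * x ^ 2 ^ t + x = 0} =
      {x : F | σ (σ x) + c * σ x + x = 0} := by
    simp only [hσσ]
    simp only [hσ]
  have hgeq : {y : F | (y ^ (2 ^ t + 1) + c * y + 1 = 0) ∧ y ^ 2 ^ n = y} =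
      {y : F | y * σ y + c * y + 1 = 0 ∧ τ y = y} := by
    simp only [hτ, hσ, pow_succ']
  rw [hfeq, hgeq]
  have hk2 : 2 ≤ 2 ^ k := Nat.le_self_pow (by omega) 2
  have hk4 : 2 ≤ 2 ^ (2 * k) := Nat.le_self_pow (by omega) 2
  by_cases htriv : ∀ x : F, σ (σ x) + c * σ x + x = 0 → x = 0
  · have hV : Nat.card {x : F | σ (σ x) + c * σ x + x = 0} = 1 := by
      have : {x : F | σ (σ x) + c * σ x + x = 0} = {0} := by
        ext x
        simp only [Set.mem_ofPred_eq, Set.mem_singleton_iff]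
        refine ⟨htriv x, ?_⟩
        rintro rfl
        simp
      rw [this]
      simp
    have hZ := card_riccati_of_trivial σ τ hστ htriv
    omega
  · push Not at htriv
    obtain ⟨z, hz, hz0⟩ := htriv
    have hex : ∃ x : F, x ≠ 0 ∧ σ (σ x) + c * σ x + x = 0 ∧ τ x = x := by
      by_cases hzz : τ z = z
      · exact ⟨z, hz0, hz, hzz⟩
      · refine ⟨τ z + z, fun h => hzz (CharTwo.add_eq_zero.mp h), ?_, ?_⟩
        · have h := congrArg τ hz
          simp only [map_add, map_mul, hτc, map_zero, ← hστ] at h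
          simp only [map_add]
          linear_combination h + hz
        · rw [map_add, hττ, add_comm]
    obtain ⟨x, hx0, hx, hτx⟩ := hex
    have hτσ : τ (σ x) = σ x := by rw [← hστ, hτx]
    obtain ⟨v, hv⟩ := exists_add_eq_of_involution τ hττ hcardK
      (w := (x * σ x)⁻¹) (by rw [map_inv₀, map_mul, hτσ, hτx])
    obtain ⟨u, hu⟩ := exists_add_eq_iterate_add σ r v
    rw [hiter, hv] at hu
    have hV := card_linear_recurrence_eq_sq σ hx0 hx hu
    rw [hcard0, ← pow_mul, mul_comm k] at hV
    have hZ := card_riccati_of_nontrivial σ τ hfix hx0 hx hτσ hτx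
    rw [hcard0] at hZ
    omega
end
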